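/- Let a₀ ∈ (0,1) be the unique real root of 54a³ − 27a² = 1 (a₀ ≈ 0.5592), let k ≥ 1, and let 0 < a < a₀ with a ≠ 1/3. Then M_{k,a} is differentiable at Lebesgue-almost every x ∈ (0,1), and, with N_{k,a} the set of x ∈ (0,1) at which M_{k,a} has neither a finite nor an infinite derivative and D⁰_{k,a} := {x ∈ (0,1) : M_{k,a}'(x) = 0}, one has dim_H N_{k,a} = dim_H((0,1) \ D⁰_{k,a}) = d(a) > 0, where dim_H denotes Hausdorff dimension. -/

import Mathlib

open Filter Topology MeasureTheory Set
open scoped ENNReal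

/-- The `(n+1)`-th ternary digit of `x` (choosing the expansion ending in all `0`s
when two expansions exist, and the all-`2`s expansion for `x = 1`). -/
noncomputable def tDigit (x : ℝ) (n : ℕ) : ℕ :=
  if x = 1 then 2 else (⌊(3:ℝ) ^ (n + 1) * x⌋ - 3 * ⌊(3:ℝ) ^ n * x⌋).toNat

/-- `l_n(x)`: the number of `1`s among the first `n` ternary digits of `x`. -/
noncomputable def lCount (x : ℝ) (n : ℕ) : ℕ :=
  ((Finset.range n).filter (fun i => tDigit x i = 1)).card

/-- `q_a(d)` with `q_a(0)=0`, `q_a(1)=a`, `q_a(2)=1-a`. -/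
noncomputable def qDig (a : ℝ) (d : ℕ) : ℝ :=
  if d = 0 then 0 else if d = 1 then a else 1 - a

/-- Okamoto's function `F_a`. -/
noncomputable def Okamoto (a x : ℝ) : ℝ :=
  ∑' n : ℕ, a ^ (n - lCount x n) * (1 - 2 * a) ^ lCount x n * qDig a (tDigit x n)

/-- `M_{k,a}(x)`: the `k`-th partial derivative of `F_a(x)` with respect to `a`. -/
noncomputable def Mfun (k : ℕ) (a x : ℝ) : ℝ :=
  iteratedDeriv k (fun b => Okamoto b x) a

/-- `f` has derivative `+∞` at `x` (difference quotients over `y ∈ [0,1] \ {x}`). -/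
def derivPInf (f : ℝ → ℝ) (x : ℝ) : Prop :=
  Tendsto (fun y => (f y - f x) / (y - x)) (𝓝[Set.Icc 0 1 \ {x}] x) atTop

/-- `f` has derivative `-∞` at `x`. -/
def derivMInf (f : ℝ → ℝ) (x : ℝ) : Prop :=
  Tendsto (fun y => (f y - f x) / (y - x)) (𝓝[Set.Icc 0 1 \ {x}] x) atBot

noncomputable def phiOk (a : ℝ) : ℝ :=
  if a = 1/3 then 1/3 else if a = 1/2 then 0
  else Real.log (3 * a) / (Real.log a - Real.log |1 - 2 * a|)

noncomputable def C0 (a : ℝ) : ℝ := 1 / (Real.log a - Real.log |1 - 2 * a|)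

noncomputable def hEnt (p : ℝ) : ℝ :=
  (-(p * Real.log p) - (1 - p) * Real.log (1 - p) + (1 - p) * Real.log 2) / Real.log 3

noncomputable def dOk (a : ℝ) : ℝ := hEnt (phiOk a)

noncomputable def dTilde (a : ℝ) : ℝ := hEnt (1 - 2 * a)

/-- Complex version of `qDig`. -/
noncomputable def qDigC (z : ℂ) (d : ℕ) : ℂ :=
  if d = 0 then 0 else if d = 1 then z else 1 - z

/-- Slope ratio attached to a ternary digit, for a complex parameter. -/
noncomputable def slopeC (z : ℂ) (d : ℕ) : ℂ := if d = 1 then 1 - 2 * z else z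

/-- Okamoto's function with complex parameter. -/
noncomputable def OkamotoC (z : ℂ) (x : ℝ) : ℂ :=
  ∑' n : ℕ, z ^ (n - lCount x n) * (1 - 2 * z) ^ lCount x n * qDigC z (tDigit x n)

lemma OkamotoC_ofReal (b x : ℝ) : OkamotoC (b : ℂ) x = ((Okamoto b x : ℝ) : ℂ) := by
  unfold OkamotoC Okamoto
  rw [Complex.ofReal_tsum]
  refine tsum_congr fun n => ?_
  have : qDigC (b : ℂ) (tDigit x n) = ((qDig b (tDigit x n) : ℝ) : ℂ) := by
    unfold qDigC qDig; split_ifs <;> push_cast <;> rfl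
  rw [this]; push_cast; rfl

lemma lCount_le (x : ℝ) (n : ℕ) : lCount x n ≤ n := by
  simpa [lCount] using Finset.card_filter_le (Finset.range n) (fun i => tDigit x i = 1)

lemma norm_term_le {z : ℂ} {ρ : ℝ} (hz : ‖z‖ ≤ ρ) (hz' : ‖1 - 2 * z‖ ≤ ρ) (hρ : ρ ≤ 1)
    (x : ℝ) (n : ℕ) :
    ‖z ^ (n - lCount x n) * (1 - 2 * z) ^ lCount x n * qDigC z (tDigit x n)‖ ≤ 2 * ρ ^ n := by
  have hρ0 : 0 ≤ ρ := (norm_nonneg z).trans hz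
  have hq : ‖qDigC z (tDigit x n)‖ ≤ 2 := by
    unfold qDigC
    split_ifs
    · simp
    · linarith
    · calc ‖1 - z‖ ≤ ‖(1 : ℂ)‖ + ‖z‖ := norm_sub_le _ _
        _ ≤ 2 := by simp; linarith
  rw [norm_mul, norm_mul, norm_pow, norm_pow]
  calc _ ≤ ρ ^ (n - lCount x n) * ρ ^ lCount x n * 2 := by gcongr
    _ = 2 * ρ ^ n := by
      rw [← pow_add, Nat.sub_add_cancel (lCount_le x n)]; ring

lemma summable_OkamotoC {z : ℂ} (hz : ‖z‖ < 1) (hz' : ‖1 - 2 * z‖ < 1) (x : ℝ) :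
    Summable fun n : ℕ =>
      z ^ (n - lCount x n) * (1 - 2 * z) ^ lCount x n * qDigC z (tDigit x n) := by
  refine Summable.of_norm_bounded (g := fun n => 2 * (max ‖z‖ ‖1 - 2 * z‖) ^ n) ?_
    (fun n => norm_term_le (le_max_left _ _) (le_max_right _ _) (max_le hz.le hz'.le) x n)
  exact (summable_geometric_of_lt_one (le_max_of_le_left (norm_nonneg _)) (max_lt hz hz')).mul_left 2

lemma norm_OkamotoC_le {z : ℂ} {ρ : ℝ} (hz : ‖z‖ ≤ ρ) (hz' : ‖1 - 2 * z‖ ≤ ρ) (hρ : ρ < 1)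
    (x : ℝ) : ‖OkamotoC z x‖ ≤ 2 * (1 - ρ)⁻¹ := by
  have hρ0 : 0 ≤ ρ := (norm_nonneg z).trans hz
  exact tsum_of_norm_bounded ((hasSum_geometric_of_lt_one hρ0 hρ).mul_left 2)
    (fun n => norm_term_le hz hz' hρ.le x n)

lemma differentiableOn_OkamotoC {U : Set ℂ} (hU : IsOpen U) {ρ : ℝ} (h0 : 0 ≤ ρ) (hρ : ρ < 1)
    (hz : ∀ z ∈ U, ‖z‖ ≤ ρ) (hz' : ∀ z ∈ U, ‖1 - 2 * z‖ ≤ ρ) (x : ℝ) :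
    DifferentiableOn ℂ (fun z => OkamotoC z x) U := by
  refine Complex.differentiableOn_tsum_of_summable_norm
    (u := fun n => 2 * ρ ^ n) ((summable_geometric_of_lt_one h0 hρ).mul_left 2) ?_ hU
    (fun n z h => norm_term_le (hz z h) (hz' z h) hρ.le x n)
  intro n
  unfold qDigC
  split_ifs <;> fun_prop

lemma tDigit_zero_add_div {t : ℝ} (h0 : 0 ≤ t) (h1 : t < 1) {d : ℕ} (hd : d < 3) :
    tDigit ((t + d) / 3) 0 = d := by
  have hd' : (d : ℝ) ≤ 2 := by exact_mod_cast Nat.le_of_lt_succ hd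
  have hne : (t + d) / 3 ≠ 1 := by intro h; linarith
  have e : (3 : ℝ) ^ 1 * ((t + d) / 3) = t + (d : ℕ) := by ring
  have e0 : ⌊(3 : ℝ) ^ 0 * ((t + d) / 3)⌋ = 0 := by
    rw [Int.floor_eq_zero_iff]; constructor <;> [positivity; (norm_num; linarith)]
  rw [tDigit, if_neg hne, zero_add, e, e0, Int.floor_add_natCast,
    Int.floor_eq_zero_iff.mpr ⟨h0, h1⟩]
  simp

lemma tDigit_succ_add_div {t : ℝ} (h1 : t < 1) {d : ℕ} (hd : d < 3) (n : ℕ) :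
    tDigit ((t + d) / 3) (n + 1) = tDigit t n := by
  have hd' : (d : ℝ) ≤ 2 := by exact_mod_cast Nat.le_of_lt_succ hd
  have hne : (t + d) / 3 ≠ 1 := by intro h; linarith
  have e (m : ℕ) : ⌊(3 : ℝ) ^ (m + 1) * ((t + d) / 3)⌋ = ⌊(3 : ℝ) ^ m * t⌋ + ((3 ^ m * d : ℕ) : ℤ) := by
    rw [← Int.floor_add_natCast]; congr 1; push_cast; ring
  rw [tDigit, tDigit, if_neg hne, if_neg h1.ne, e, e]
  congr 1; push_cast; ring

lemma lCount_succ_add_div {t : ℝ} (h0 : 0 ≤ t) (h1 : t < 1) {d : ℕ} (hd : d < 3) (n : ℕ) :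
    lCount ((t + d) / 3) (n + 1) = lCount t n + if d = 1 then 1 else 0 := by
  simp only [lCount, Finset.card_filter]
  rw [Finset.sum_range_succ', tDigit_zero_add_div h0 h1 hd]
  simp only [tDigit_succ_add_div h1 hd]

lemma OkamotoC_add_div_of_lt {z : ℂ} (hz : ‖z‖ < 1) (hz' : ‖1 - 2 * z‖ < 1) {t : ℝ}
    (h0 : 0 ≤ t) (h1 : t < 1) {d : ℕ} (hd : d < 3) :
    OkamotoC z ((t + d) / 3) = qDigC z d + slopeC z d * OkamotoC z t := by
  rw [OkamotoC, (summable_OkamotoC hz hz' _).tsum_eq_zero_add, tDigit_zero_add_div h0 h1 hd]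
  congr 1
  · simp [lCount]
  · rw [OkamotoC, ← tsum_mul_left]
    refine tsum_congr fun n => ?_
    rw [lCount_succ_add_div h0 h1 hd, tDigit_succ_add_div h1 hd, slopeC]
    have := lCount_le t n
    split_ifs
    · rw [Nat.add_sub_add_right]; ring
    · rw [add_zero, Nat.succ_sub this, Nat.succ_eq_add_one]; ring

lemma OkamotoC_zero (z : ℂ) : OkamotoC z 0 = 0 := by
  have (n : ℕ) : tDigit 0 n = 0 := by simp [tDigit]
  simp [OkamotoC, this, qDigC]

lemma OkamotoC_one {z : ℂ} (hz : ‖z‖ < 1) : OkamotoC z 1 = 1 := by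
  have (n : ℕ) : tDigit 1 n = 2 := by simp [tDigit]
  have h1 : (1 : ℂ) - z ≠ 0 := by
    intro h; rw [sub_eq_zero] at h; rw [← h] at hz; simp at hz
  simp only [OkamotoC, lCount, this, qDigC]
  simp [tsum_mul_right, tsum_geometric_of_norm_lt_one hz, h1]

lemma OkamotoC_add_div {z : ℂ} (hz : ‖z‖ < 1) (hz' : ‖1 - 2 * z‖ < 1) {t : ℝ}
    (h0 : 0 ≤ t) (h1 : t ≤ 1) {d : ℕ} (hd : d < 3) :
    OkamotoC z ((t + d) / 3) = qDigC z d + slopeC z d * OkamotoC z t := by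
  rcases h1.lt_or_eq with h1 | rfl
  · exact OkamotoC_add_div_of_lt hz hz' h0 h1 hd
  · have key (e : ℕ) (he : e < 3) : OkamotoC z ((e : ℝ) / 3) = qDigC z e := by
      have := OkamotoC_add_div_of_lt hz hz' le_rfl zero_lt_one he
      simpa [OkamotoC_zero] using this
    rw [OkamotoC_one hz]
    interval_cases d
    · have := key 1 (by norm_num); norm_num at this ⊢; rw [this]; simp [qDigC, slopeC]
    · have := key 2 (by norm_num); norm_num at this ⊢; rw [this]; simp [qDigC, slopeC]; ring
    · norm_num; rw [OkamotoC_one hz]; simp [qDigC, slopeC]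

/-- The number of digits `1` in the ternary representation of a natural number. -/
def onesCount (j : ℕ) : ℕ := (Nat.digits 3 j).count 1

lemma onesCount_three_mul_add (j : ℕ) {d : ℕ} (hd : d < 3) :
    onesCount (3 * j + d) = onesCount j + if d = 1 then 1 else 0 := by
  unfold onesCount
  rcases Nat.eq_zero_or_pos (3 * j + d) with h | h
  · obtain rfl : j = 0 := by omega
    obtain rfl : d = 0 := by omega
    simp
  · rw [Nat.digits_def' (by norm_num) h, Nat.mul_add_mod, Nat.mod_eq_of_lt hd,
      Nat.mul_add_div (by norm_num), Nat.div_eq_of_lt hd, add_zero, List.count_cons]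
    simp

lemma onesCount_zero : onesCount 0 = 0 := by simp [onesCount]

lemma exists_eq_three_mul_add (j : ℕ) : ∃ j' d, d < 3 ∧ j = 3 * j' + d :=
  ⟨j / 3, j % 3, Nat.mod_lt _ (by norm_num), (Nat.div_add_mod j 3).symm⟩

lemma onesCount_le {n j : ℕ} (h : j < 3 ^ n) : onesCount j ≤ n := by
  induction n generalizing j with
  | zero => obtain rfl : j = 0 := by simpa using h
            simp [onesCount_zero]
  | succ n ih =>
    obtain ⟨j', d, hd, rfl⟩ := exists_eq_three_mul_add j
    rw [onesCount_three_mul_add _ hd]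
    have := ih (j := j') (by rw [pow_succ] at h; omega)
    split_ifs <;> omega

lemma onesCount_succ (j : ℕ) :
    onesCount (j + 1) ≤ onesCount j + 1 ∧ onesCount j ≤ onesCount (j + 1) + 1 := by
  induction j using Nat.strong_induction_on with
  | _ j ih =>
    obtain ⟨j', d, hd, rfl⟩ := exists_eq_three_mul_add j
    interval_cases d
    · have := onesCount_three_mul_add j' (d := 1) (by norm_num)
      have := onesCount_three_mul_add j' (d := 0) (by norm_num)
      simp_all
      omega
    · have := onesCount_three_mul_add j' (d := 1) (by norm_num)
      have := onesCount_three_mul_add j' (d := 2) (by norm_num)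
      simp_all
      omega
    · have h1 := onesCount_three_mul_add j' (d := 2) (by norm_num)
      have h2 := onesCount_three_mul_add (j' + 1) (d := 0) (by norm_num)
      have := ih j' (by omega)
      rw [h1, show 3 * j' + 2 + 1 = 3 * (j' + 1) + 0 by ring, h2]
      simpa using this

lemma OkamotoC_affine {z : ℂ} (hz : ‖z‖ < 1) (hz' : ‖1 - 2 * z‖ < 1) {n j : ℕ} (hj : j < 3 ^ n)
    {t : ℝ} (h0 : 0 ≤ t) (h1 : t ≤ 1) :
    OkamotoC z ((t + j) / 3 ^ n) = OkamotoC z (j / 3 ^ n) +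
      z ^ (n - onesCount j) * (1 - 2 * z) ^ onesCount j * OkamotoC z t := by
  induction n generalizing j t with
  | zero =>
    obtain rfl : j = 0 := by simpa using hj
    simp [OkamotoC_zero, onesCount_zero]
  | succ n ih =>
    obtain ⟨j', d, hd, rfl⟩ := exists_eq_three_mul_add j
    have hj' : j' < 3 ^ n := by rw [pow_succ] at hj; omega
    have hd' : (d : ℝ) ≤ 2 := by exact_mod_cast Nat.le_of_lt_succ hd
    have key (s : ℝ) (s0 : 0 ≤ s) (s1 : s ≤ 1) :
        OkamotoC z ((s + (3 * j' + d : ℕ)) / 3 ^ (n + 1)) = OkamotoC z (j' / 3 ^ n) +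
          z ^ (n - onesCount j') * (1 - 2 * z) ^ onesCount j' *
            (qDigC z d + slopeC z d * OkamotoC z s) := by
      rw [← OkamotoC_add_div hz hz' s0 s1 hd, ← ih hj' (by positivity) (by linarith)]
      congr 1; push_cast; field_simp; ring
    have k0 := key 0 le_rfl zero_le_one
    rw [zero_add, OkamotoC_zero] at k0
    rw [key t h0 h1, k0, onesCount_three_mul_add _ hd, slopeC]
    have := onesCount_le hj'
    split_ifs
    · rw [Nat.add_sub_add_right]; ring
    · rw [add_zero, Nat.succ_sub this, Nat.succ_eq_add_one]; ring

lemma iteratedDeriv_eq_re {F : ℂ → ℂ} {U : Set ℂ} (hU : IsOpen U) (hF : DifferentiableOn ℂ F U)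
    {f : ℝ → ℝ} (hf : ∀ b : ℝ, (b : ℂ) ∈ U → F b = (f b : ℂ)) (k : ℕ) {b : ℝ} (hb : (b : ℂ) ∈ U) :
    iteratedDeriv k f b = (iteratedDeriv k F b).re := by
  induction k generalizing b with
  | zero => simp [hf b hb]
  | succ k ih =>
    have hev : iteratedDeriv k f =ᶠ[𝓝 b] fun y : ℝ => (iteratedDeriv k F y).re := by
      filter_upwards [(hU.preimage Complex.continuous_ofReal).mem_nhds hb] with y hy using ih hy
    have hd : DifferentiableAt ℂ (iteratedDeriv k F) b := by
      have : AnalyticAt ℂ F b := hF.analyticAt (hU.mem_nhds hb)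
      exact (this.iterated_deriv k |>.differentiableAt.congr_of_eventuallyEq
        (by rw [iteratedDeriv_eq_iterate]))
    rw [iteratedDeriv_succ, hev.deriv_eq, iteratedDeriv_succ]
    exact hd.hasDerivAt.real_of_complex.deriv

/-- The parameters for which both slope ratios have modulus less than `ρ`. -/
def slopeDomain (ρ : ℝ) : Set ℂ := {z | ‖z‖ < ρ ∧ ‖1 - 2 * z‖ < ρ}

lemma isOpen_slopeDomain (ρ : ℝ) : IsOpen (slopeDomain ρ) :=
  (isOpen_lt continuous_norm continuous_const).inter
    (isOpen_lt (f := fun z : ℂ => ‖1 - 2 * z‖) (by fun_prop) continuous_const)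

lemma differentiableOn_OkamotoC_slopeDomain {ρ : ℝ} (h0 : 0 ≤ ρ) (hρ : ρ < 1) (x : ℝ) :
    DifferentiableOn ℂ (fun z => OkamotoC z x) (slopeDomain ρ) :=
  differentiableOn_OkamotoC (isOpen_slopeDomain ρ) h0 hρ (fun _ h => h.1.le) (fun _ h => h.2.le) x

lemma exists_ofReal_mem_slopeDomain {a : ℝ} (h0 : 0 < a) (h1 : a < 1) :
    ∃ ρ : ℝ, 0 ≤ ρ ∧ ρ < 1 ∧ (a : ℂ) ∈ slopeDomain ρ := by
  have h2 : |1 - 2 * a| < 1 := by rw [abs_lt]; constructor <;> linarith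
  obtain ⟨ρ, h, h'⟩ := exists_between (max_lt h1 h2)
  rw [max_lt_iff] at h
  refine ⟨ρ, by linarith, h', ?_, ?_⟩
  · simpa [abs_of_pos h0] using h.1
  · have : (1 - 2 * (a : ℂ)) = ((1 - 2 * a : ℝ) : ℂ) := by push_cast; rfl
    rw [this, Complex.norm_real]; exact h.2

lemma Mfun_sub_eq_re {ρ : ℝ} (h0 : 0 ≤ ρ) (hρ : ρ < 1) {a : ℝ} (ha : (a : ℂ) ∈ slopeDomain ρ)
    (k : ℕ) (x y : ℝ) :
    Mfun k a y - Mfun k a x =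
      (iteratedDeriv k (fun z => OkamotoC z y - OkamotoC z x) (a : ℂ)).re := by
  have hd (x : ℝ) := differentiableOn_OkamotoC_slopeDomain h0 hρ x
  have hc (x : ℝ) : ContDiffAt ℂ k (fun z => OkamotoC z x) (a : ℂ) :=
    ((hd x).analyticAt ((isOpen_slopeDomain ρ).mem_nhds ha)).contDiffAt
  have hM (x : ℝ) : Mfun k a x = (iteratedDeriv k (fun z => OkamotoC z x) (a : ℂ)).re :=
    iteratedDeriv_eq_re (isOpen_slopeDomain ρ) (hd x) (fun b _ => OkamotoC_ofReal b x) k ha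
  rw [hM, hM, ← Complex.sub_re, iteratedDeriv_fun_sub (hc y) (hc x)]

lemma Mfun_sub_triadic {a : ℝ} (h0 : 0 < a) (h1 : a < 1) (k : ℕ) {n j : ℕ} (hj : j < 3 ^ n) :
    Mfun k a ((1 + j) / 3 ^ n) - Mfun k a (j / 3 ^ n) =
      iteratedDeriv k (fun b : ℝ => b ^ (n - onesCount j) * (1 - 2 * b) ^ onesCount j) a := by
  obtain ⟨ρ, hρ0, hρ1, ha⟩ := exists_ofReal_mem_slopeDomain h0 h1
  rw [Mfun_sub_eq_re hρ0 hρ1 ha]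
  have hev : (fun z => OkamotoC z ((1 + j) / 3 ^ n) - OkamotoC z (j / 3 ^ n)) =ᶠ[𝓝 (a : ℂ)]
      fun z => z ^ (n - onesCount j) * (1 - 2 * z) ^ onesCount j := by
    filter_upwards [(isOpen_slopeDomain ρ).mem_nhds ha] with z hz
    have hz1 := hz.1.trans hρ1
    rw [OkamotoC_affine hz1 (hz.2.trans hρ1) hj zero_le_one le_rfl, OkamotoC_one hz1]
    ring
  rw [hev.iteratedDeriv_eq]
  symm
  refine iteratedDeriv_eq_re isOpen_univ (by fun_prop) (fun b _ => ?_) k (mem_univ _)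
  push_cast; rfl

lemma iteratedDeriv_one_sub_two_mul_pow (l i : ℕ) (a : ℝ) :
    iteratedDeriv i (fun b : ℝ => (1 - 2 * b) ^ l) a =
      l.descFactorial i * (-2) ^ i * (1 - 2 * a) ^ (l - i) := by
  induction i generalizing a with
  | zero => simp
  | succ i ih =>
    rw [iteratedDeriv_succ, show iteratedDeriv i (fun b : ℝ => (1 - 2 * b) ^ l) = _ from funext ih]
    have h : HasDerivAt (fun b : ℝ => 1 - 2 * b) (-2) a := by
      simpa using ((hasDerivAt_id a).const_mul 2).const_sub 1
    rw [((h.fun_pow (l - i)).const_mul _).deriv, Nat.descFactorial_succ, Nat.sub_sub, Nat.cast_mul]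
    ring

lemma iteratedDeriv_slope (m l k : ℕ) (a : ℝ) :
    iteratedDeriv k (fun b : ℝ => b ^ m * (1 - 2 * b) ^ l) a =
      ∑ i ∈ Finset.range (k + 1), (k.choose i : ℝ) * (m.descFactorial i * a ^ (m - i)) *
        (l.descFactorial (k - i) * (-2) ^ (k - i) * (1 - 2 * a) ^ (l - (k - i))) := by
  rw [iteratedDeriv_fun_mul (by fun_prop) (by fun_prop)]
  refine Finset.sum_congr rfl fun i _ => ?_
  rw [iteratedDeriv_pow, iteratedDeriv_one_sub_two_mul_pow]

lemma floor_triadic {x : ℝ} (h0 : 0 ≤ x) (h1 : x < 1) (n : ℕ) :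
    ⌊(3 : ℝ) ^ n * x⌋₊ < 3 ^ n ∧
      ∃ t : ℝ, 0 ≤ t ∧ t ≤ 1 ∧ x = (t + (⌊(3 : ℝ) ^ n * x⌋₊ : ℕ)) / 3 ^ n := by
  have h3 : (0 : ℝ) < 3 ^ n := by positivity
  refine ⟨?_, (3 : ℝ) ^ n * x - ⌊(3 : ℝ) ^ n * x⌋₊, ?_, ?_, ?_⟩
  · rw [Nat.floor_lt (by positivity)]; push_cast; nlinarith
  · linarith [Nat.floor_le (show 0 ≤ (3 : ℝ) ^ n * x by positivity)]
  · linarith [Nat.lt_floor_add_one ((3 : ℝ) ^ n * x)]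
  · field_simp; ring

lemma norm_OkamotoC_sub_left_le {z : ℂ} {ρ A B : ℝ} (hz : ‖z‖ ≤ ρ) (hz' : ‖1 - 2 * z‖ ≤ ρ)
    (hρ : ρ < 1) (hA : 0 < A) (hB : 0 < B) (hzA : ‖z‖ ≤ A) (hzB : ‖1 - 2 * z‖ ≤ B)
    {n j : ℕ} (hj : j < 3 ^ n) {t : ℝ} (h0 : 0 ≤ t) (h1 : t ≤ 1) :
    ‖OkamotoC z ((t + j) / 3 ^ n) - OkamotoC z (j / 3 ^ n)‖ ≤
      2 * (1 - ρ)⁻¹ * (A ^ n * (B / A) ^ onesCount j) := by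
  have hD := norm_OkamotoC_le hz hz' hρ t
  rw [OkamotoC_affine (hz.trans_lt hρ) (hz'.trans_lt hρ) hj h0 h1, add_sub_cancel_left, norm_mul,
    norm_mul, norm_pow, norm_pow, mul_comm]
  have e : A ^ n * (B / A) ^ onesCount j = A ^ (n - onesCount j) * B ^ onesCount j := by
    obtain ⟨m, hm⟩ := Nat.exists_eq_add_of_le (onesCount_le hj)
    have : n - onesCount j = m := by omega
    rw [this, div_pow]
    conv_lhs => rw [hm, pow_add]
    field_simp
  rw [e]
  gcongr

lemma pow_le_of_near {q : ℝ} (hq : 0 < q) {l l' : ℕ} (h : l' ≤ l + 1) (h' : l ≤ l' + 1) :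
    q ^ l' ≤ (q + q⁻¹ + 1) * q ^ l := by
  have hp (m : ℕ) : 0 < q ^ m := by positivity
  have hi : 0 < q⁻¹ := by positivity
  have hlt : l' = l + 1 ∨ l' = l ∨ l = l' + 1 := by omega
  rcases hlt with rfl | rfl | rfl
  · rw [pow_succ]; nlinarith [hp l, mul_pos hi (hp l)]
  · nlinarith [hp l', mul_pos hi (hp l'), mul_pos hq (hp l')]
  · rw [pow_succ]
    have : q⁻¹ * (q ^ l' * q) = q ^ l' := by field_simp
    nlinarith [hp l', mul_pos hq (mul_pos (hp l') hq), mul_pos (hp l') hq]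

lemma norm_OkamotoC_sub_le {z : ℂ} {ρ A B : ℝ} (hz : ‖z‖ ≤ ρ) (hz' : ‖1 - 2 * z‖ ≤ ρ)
    (hρ : ρ < 1) (hA : 0 < A) (hB : 0 < B) (hzA : ‖z‖ ≤ A) (hzB : ‖1 - 2 * z‖ ≤ B)
    {x y : ℝ} (hx0 : 0 ≤ x) (hx1 : x < 1) (hy0 : 0 ≤ y) (hy1 : y < 1) {n : ℕ}
    (hxy : |y - x| ≤ (1 / 3) ^ n) :
    ‖OkamotoC z y - OkamotoC z x‖ ≤
      4 * (1 - ρ)⁻¹ * (B / A + (B / A)⁻¹ + 2) *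
        (A ^ n * (B / A) ^ onesCount ⌊(3 : ℝ) ^ n * x⌋₊) := by
  have h3 : (0 : ℝ) < 3 ^ n := by positivity
  set q := B / A with hq
  have hq0 : 0 < q := by positivity
  have hq1 : 0 < q⁻¹ := by positivity
  have hD : 0 < 2 * (1 - ρ)⁻¹ := by
    have : 0 < 1 - ρ := by linarith
    positivity
  have key := fun {j : ℕ} (hj : j < 3 ^ n) {t : ℝ} (h0 : 0 ≤ t) (h1 : t ≤ 1) =>
    norm_OkamotoC_sub_left_le hz hz' hρ hA hB hzA hzB hj h0 h1
  rw [← hq] at key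
  obtain ⟨hi, s, s0, s1, hs⟩ := floor_triadic hx0 hx1 n
  obtain ⟨hj, t, t0, t1, ht⟩ := floor_triadic hy0 hy1 n
  have hdist : |(3 : ℝ) ^ n * y - 3 ^ n * x| ≤ 1 := by
    rw [← mul_sub, abs_mul, abs_of_pos h3]
    calc (3 : ℝ) ^ n * |y - x| ≤ 3 ^ n * (1 / 3) ^ n := by gcongr
      _ = 1 := by rw [← mul_pow]; norm_num
  rw [abs_le] at hdist
  have hfl : ⌊(3 : ℝ) ^ n * y⌋₊ ≤ ⌊(3 : ℝ) ^ n * x⌋₊ + 1 := by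
    rw [← Nat.floor_add_one (by positivity)]; exact Nat.floor_le_floor (by linarith)
  have hfl' : ⌊(3 : ℝ) ^ n * x⌋₊ ≤ ⌊(3 : ℝ) ^ n * y⌋₊ + 1 := by
    rw [← Nat.floor_add_one (by positivity)]; exact Nat.floor_le_floor (by linarith)
  generalize ⌊(3 : ℝ) ^ n * x⌋₊ = i at *
  generalize ⌊(3 : ℝ) ^ n * y⌋₊ = j at *
  have kx := key hi s0 s1
  have ky := key hj t0 t1
  have ki := key hi zero_le_one le_rfl
  have kj := key hj zero_le_one le_rfl
  rw [← hs] at kx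
  rw [← ht] at ky
  set Wi := A ^ n * q ^ onesCount i with hWi
  set Wj := A ^ n * q ^ onesCount j with hWj
  have hWi0 : 0 < Wi := by positivity
  have hW : Wj ≤ (q + q⁻¹ + 1) * Wi := by
    have hn : onesCount j ≤ onesCount i + 1 ∧ onesCount i ≤ onesCount j + 1 := by
      have : j = i + 1 ∨ j = i ∨ i = j + 1 := by omega
      rcases this with rfl | rfl | rfl
      · exact onesCount_succ i
      · omega
      · exact (onesCount_succ j).symm
    calc Wj ≤ A ^ n * ((q + q⁻¹ + 1) * q ^ onesCount i) := by
          rw [hWj]; gcongr; exact pow_le_of_near hq0 hn.1 hn.2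
      _ = _ := by rw [hWi]; ring
  have hfin : 2 * (1 - ρ)⁻¹ * Wi + 2 * (1 - ρ)⁻¹ * Wi + 2 * (1 - ρ)⁻¹ * Wj
      + 2 * (1 - ρ)⁻¹ * Wj ≤ 4 * (1 - ρ)⁻¹ * (q + q⁻¹ + 2) * Wi := by
    nlinarith [mul_le_mul_of_nonneg_left hW hD.le]
  have hWj0 : 0 < Wj := by positivity
  have hp1 := mul_pos hD hWi0
  have hp2 := mul_pos hD hWj0
  have : j = i + 1 ∨ j = i ∨ i = j + 1 := by omega
  refine le_trans ?_ hfin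
  rcases this with rfl | rfl | rfl
  · have e : ((1 : ℝ) + i) = ((i + 1 : ℕ) : ℝ) := by push_cast; ring
    rw [e] at ki
    rw [show OkamotoC z y - OkamotoC z x =
      (OkamotoC z y - OkamotoC z ((i + 1 : ℕ) / 3 ^ n)) +
      (OkamotoC z ((i + 1 : ℕ) / 3 ^ n) - OkamotoC z (i / 3 ^ n)) -
      (OkamotoC z x - OkamotoC z (i / 3 ^ n)) by ring]
    refine (norm_sub_le _ _).trans ((add_le_add (norm_add_le _ _) le_rfl).trans ?_)
    linarith
  · rw [show OkamotoC z y - OkamotoC z x = (OkamotoC z y - OkamotoC z (j / 3 ^ n)) -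
      (OkamotoC z x - OkamotoC z (j / 3 ^ n)) by ring]
    refine (norm_sub_le _ _).trans ?_
    linarith
  · have e : ((1 : ℝ) + j) = ((j + 1 : ℕ) : ℝ) := by push_cast; ring
    rw [e] at kj
    rw [show OkamotoC z y - OkamotoC z x =
      (OkamotoC z y - OkamotoC z (j / 3 ^ n)) -
      (OkamotoC z ((j + 1 : ℕ) / 3 ^ n) - OkamotoC z (j / 3 ^ n)) -
      (OkamotoC z x - OkamotoC z ((j + 1 : ℕ) / 3 ^ n)) by ring]
    refine (norm_sub_le _ _).trans ((add_le_add (norm_sub_le _ _) le_rfl).trans ?_)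
    linarith

lemma exists_abs_Mfun_sub_le {a r : ℝ} (ha : 0 < a) (hr : 0 < r) (h1 : a + r < 1)
    (h2 : |1 - 2 * a| + 2 * r < 1) (k : ℕ) :
    ∃ C : ℝ, 0 < C ∧ ∀ (n : ℕ) (x y : ℝ), 0 ≤ x → x < 1 → 0 ≤ y → y < 1 → |y - x| ≤ (1 / 3) ^ n →
      |Mfun k a y - Mfun k a x| ≤ C * ((a + r) ^ n *
        ((|1 - 2 * a| + 2 * r) / (a + r)) ^ onesCount ⌊(3 : ℝ) ^ n * x⌋₊) := by
  set A := a + r with hA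
  set B := |1 - 2 * a| + 2 * r with hB
  have hA0 : 0 < A := by positivity
  have hB0 : 0 < B := by positivity
  obtain ⟨ρ, hρ, hρ1⟩ := exists_between (max_lt h1 h2)
  rw [max_lt_iff] at hρ
  have hzA (z : ℂ) (hz : z ∈ Metric.closedBall (a : ℂ) r) : ‖z‖ ≤ A := by
    rw [mem_closedBall_iff_norm] at hz
    calc ‖z‖ = ‖(a : ℂ) + (z - a)‖ := by ring_nf
      _ ≤ ‖(a : ℂ)‖ + ‖z - a‖ := norm_add_le _ _
      _ ≤ A := by rw [Complex.norm_real, Real.norm_of_nonneg ha.le]; linarith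
  have hzB (z : ℂ) (hz : z ∈ Metric.closedBall (a : ℂ) r) : ‖1 - 2 * z‖ ≤ B := by
    rw [mem_closedBall_iff_norm] at hz
    calc ‖1 - 2 * z‖ = ‖((1 - 2 * a : ℝ) : ℂ) - 2 * (z - a)‖ := by push_cast; ring_nf
      _ ≤ ‖((1 - 2 * a : ℝ) : ℂ)‖ + ‖2 * (z - a)‖ := norm_sub_le _ _
      _ ≤ B := by
        rw [Complex.norm_real, norm_mul, Real.norm_eq_abs]
        simp only [Complex.norm_ofNat]
        linarith
  have hsub : Metric.closedBall (a : ℂ) r ⊆ slopeDomain ρ := fun z hz =>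
    ⟨(hzA z hz).trans_lt hρ.1, (hzB z hz).trans_lt hρ.2⟩
  have hρ0 : 0 ≤ ρ := by linarith
  have hD : 0 < (1 - ρ)⁻¹ := by
    have : 0 < 1 - ρ := by linarith
    positivity
  refine ⟨k.factorial * (4 * (1 - ρ)⁻¹ * (B / A + (B / A)⁻¹ + 2)) / r ^ k, by positivity, ?_⟩
  intro n x y hx0 hx1 hy0 hy1 hxy
  rw [Mfun_sub_eq_re hρ0 hρ1 (hsub (Metric.mem_closedBall_self hr.le))]
  refine (Complex.abs_re_le_norm _).trans ?_
  have hd : DifferentiableOn ℂ (fun z => OkamotoC z y - OkamotoC z x) (slopeDomain ρ) :=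
    (differentiableOn_OkamotoC_slopeDomain hρ0 hρ1 y).sub
      (differentiableOn_OkamotoC_slopeDomain hρ0 hρ1 x)
  refine (Complex.norm_iteratedDeriv_le_of_forall_mem_sphere_norm_le k hr
    (hd.diffContOnCl_ball hsub) (C := 4 * (1 - ρ)⁻¹ * (B / A + (B / A)⁻¹ + 2) *
        (A ^ n * (B / A) ^ onesCount ⌊(3 : ℝ) ^ n * x⌋₊)) fun z hz => ?_).trans (le_of_eq (by ring))
  have hz' := Metric.sphere_subset_closedBall hz
  exact norm_OkamotoC_sub_le ((hzA z hz').trans hρ.1.le) ((hzB z hz').trans hρ.2.le) hρ1 hA0 hB0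
    (hzA z hz') (hzB z hz') hx0 hx1 hy0 hy1 hxy

lemma hasDerivAt_Mfun_zero {a r : ℝ} (ha : 0 < a) (hr : 0 < r) (h1 : a + r < 1)
    (h2 : |1 - 2 * a| + 2 * r < 1) (k : ℕ) {x : ℝ} (hx : x ∈ Ioo (0 : ℝ) 1)
    (hlim : Tendsto (fun n : ℕ => (3 * (a + r)) ^ n *
      ((|1 - 2 * a| + 2 * r) / (a + r)) ^ onesCount ⌊(3 : ℝ) ^ n * x⌋₊) atTop (𝓝 0)) :
    HasDerivAt (Mfun k a) 0 x := by
  obtain ⟨C, hC, hbound⟩ := exists_abs_Mfun_sub_le ha hr h1 h2 k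
  rw [hasDerivAt_iff_isLittleO, Asymptotics.isLittleO_iff]
  intro ε hε
  have hlim' := (hlim.const_mul (3 * C)).eventually_le_const (u := ε) (by simpa using hε)
  obtain ⟨N, hN⟩ := eventually_atTop.mp hlim'
  have hnear : ∀ᶠ y in 𝓝 x, |y - x| < (1 / 3 : ℝ) ^ N := by
    have := Metric.ball_mem_nhds x (show (0 : ℝ) < (1 / 3) ^ N by positivity)
    filter_upwards [this] with y hy
    rwa [Metric.mem_ball, Real.dist_eq] at hy
  filter_upwards [hnear, isOpen_Ioo.mem_nhds hx] with y hy hy01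
  simp only [smul_zero, sub_zero, Real.norm_eq_abs]
  rcases eq_or_ne y x with rfl | hne
  · simp
  have hpos : 0 < |y - x| := abs_pos.mpr (sub_ne_zero.mpr hne)
  have hle1 : |y - x| ≤ 1 := hy.le.trans (pow_le_one₀ (by norm_num) (by norm_num))
  obtain ⟨n, hn1, hn2⟩ := exists_nat_pow_near_of_lt_one hpos hle1
    (show (0 : ℝ) < 1 / 3 by norm_num) (by norm_num)
  have hNn : N ≤ n := by
    by_contra! h
    have : (1 / 3 : ℝ) ^ N ≤ (1 / 3) ^ (n + 1) :=
      pow_le_pow_of_le_one (by norm_num) (by norm_num) h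
    linarith
  refine (hbound n x y hx.1.le hx.2 hy01.1.le hy01.2 hn2).trans ?_
  have h3 : (3 : ℝ) ^ n * (1 / 3) ^ (n + 1) = 1 / 3 := by
    rw [pow_succ, ← mul_assoc, ← mul_pow]; norm_num
  calc _ = 3 * C * ((3 * (a + r)) ^ n *
      ((|1 - 2 * a| + 2 * r) / (a + r)) ^ onesCount ⌊(3 : ℝ) ^ n * x⌋₊) * (1 / 3) ^ (n + 1) := by
        rw [mul_pow]; linear_combination (-3 * C * (a + r) ^ n *
          ((|1 - 2 * a| + 2 * r) / (a + r)) ^ onesCount ⌊(3 : ℝ) ^ n * x⌋₊) * h3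
    _ ≤ ε * |y - x| := by
        gcongr
        exact hN n hNn

lemma continuous_hEnt : Continuous hEnt := by
  have h1 : Continuous fun p : ℝ => p * Real.log p := Real.continuous_mul_log
  have h2 : Continuous fun p : ℝ => (1 - p) * Real.log (1 - p) := h1.comp (continuous_const.sub continuous_id)
  unfold hEnt
  fun_prop

lemma log_three_mul_hEnt {p : ℝ} (h1 : p < 1) :
    Real.log 3 * hEnt p = -(p * Real.log p + (1 - p) * Real.log ((1 - p) / 2)) := by
  have h3 : Real.log 3 ≠ 0 := (Real.log_pos (by norm_num)).ne'
  rw [hEnt, Real.log_div (by linarith) (by norm_num)]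
  field_simp
  ring

lemma hEnt_lt_one {p : ℝ} (h0 : 0 ≤ p) (h1 : p < 1) (hp : p ≠ 1 / 3) : hEnt p < 1 := by
  have h3 : 0 < Real.log 3 := Real.log_pos (by norm_num)
  have hlog (x : ℝ) (hx : 0 < x) : -Real.log (3 * x) ≤ 1 / (3 * x) - 1 := by
    have := Real.log_le_sub_one_of_pos (show 0 < 1 / (3 * x) by positivity)
    rwa [one_div, Real.log_inv, ← one_div] at this
  have key : Real.log 3 * hEnt p < Real.log 3 := by
    rw [log_three_mul_hEnt h1]
    have hq : 0 < (1 - p) / 2 := by linarith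
    have e2 := hlog _ hq
    have e2' : (1 - p) * -Real.log (3 * ((1 - p) / 2)) ≤ 2 / 3 - (1 - p) := by
      refine (mul_le_mul_of_nonneg_left e2 (by linarith)).trans (le_of_eq ?_)
      have : (1 - p) ≠ 0 := by linarith
      field_simp
    rw [Real.log_mul (by norm_num) hq.ne'] at e2'
    rcases h0.eq_or_lt with rfl | h0
    · norm_num at e2' ⊢
      have : Real.log (1 / 2) = - Real.log 2 := by rw [one_div, Real.log_inv]
      have := Real.log_lt_log (show (0 : ℝ) < 2 by norm_num) (show (2 : ℝ) < 3 by norm_num)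
      linarith
    · have e1 : p * -Real.log (3 * p) < 1 / 3 - p := by
        have := Real.log_lt_sub_one_of_pos (show 0 < 1 / (3 * p) by positivity) (by
          intro h; apply hp; field_simp at h; linarith)
        rw [one_div, Real.log_inv, ← one_div] at this
        refine (mul_lt_mul_of_pos_left this h0).trans_le (le_of_eq ?_)
        field_simp
      rw [Real.log_mul (by norm_num) h0.ne'] at e1
      linarith
  nlinarith

lemma hEnt_pos {p : ℝ} (h0 : 0 ≤ p) (h1 : p < 1) : 0 < hEnt p := by
  have h3 : 0 < Real.log 3 := Real.log_pos (by norm_num)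
  have h2 : 0 < Real.log 2 := Real.log_pos (by norm_num)
  have e1 : p * Real.log p ≤ 0 := mul_nonpos_of_nonneg_of_nonpos h0 (Real.log_nonpos h0 h1.le)
  have e2 : (1 - p) * Real.log (1 - p) ≤ 0 := mul_nonpos_of_nonneg_of_nonpos (by linarith)
    (Real.log_nonpos (by linarith) (by linarith))
  have e3 : 0 < (1 - p) * Real.log 2 := mul_pos (by linarith) h2
  exact div_pos (by linarith) h3

lemma sum_range_three_mul {M : Type*} [AddCommMonoid M] (f : ℕ → M) (m : ℕ) :
    ∑ j ∈ Finset.range (3 * m), f j =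
      ∑ j ∈ Finset.range m, (f (3 * j) + f (3 * j + 1) + f (3 * j + 2)) := by
  induction m with
  | zero => simp
  | succ m ih =>
    rw [Finset.sum_range_succ, ← ih, show 3 * (m + 1) = 3 * m + 1 + 1 + 1 by ring,
      Finset.sum_range_succ, Finset.sum_range_succ, Finset.sum_range_succ]
    simp only [add_assoc]

lemma sum_pow_onesCount (p q : ℝ) (n : ℕ) :
    ∑ j ∈ Finset.range (3 ^ n), p ^ onesCount j * q ^ (n - onesCount j) = (p + 2 * q) ^ n := by
  induction n with
  | zero => simp [onesCount_zero]
  | succ n ih =>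
    rw [pow_succ' 3, sum_range_three_mul, pow_succ, ← ih, Finset.sum_mul]
    refine Finset.sum_congr rfl fun j hj => ?_
    have hj' := onesCount_le (Finset.mem_range.mp hj)
    have e0 := onesCount_three_mul_add j (d := 0) (by norm_num)
    have e1 := onesCount_three_mul_add j (d := 1) (by norm_num)
    have e2 := onesCount_three_mul_add j (d := 2) (by norm_num)
    norm_num at e0 e1 e2
    rw [e0, e1, e2, Nat.add_sub_add_right, Nat.succ_sub hj', Nat.succ_eq_add_one]
    ring

/-- Points for which infinitely often the Bernoulli weight `(q, p, q)`, `q = (1 - p) / 2`, of the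
initial ternary word is at least what is expected when the digit `1` has frequency `p`. -/
def heavySet (p : ℝ) : Set ℝ :=
  {x ∈ Ioo (0 : ℝ) 1 | ∃ᶠ n : ℕ in atTop, Real.exp (-(n * (Real.log 3 * hEnt p))) ≤
    p ^ onesCount ⌊(3 : ℝ) ^ n * x⌋₊ * ((1 - p) / 2) ^ (n - onesCount ⌊(3 : ℝ) ^ n * x⌋₊)}

lemma dimH_heavySet_le {p : ℝ} (h0 : 0 < p) (h1 : p < 1) :
    dimH (heavySet p) ≤ ENNReal.ofReal (hEnt p) := by
  refine le_of_forall_gt_imp_ge_of_dense fun s' hs' => ?_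
  obtain ⟨s, hs1, hs2⟩ := ENNReal.lt_iff_exists_nnreal_btwn.mp hs'
  refine le_trans ?_ hs2.le
  have hs : hEnt p < s := by
    rwa [ENNReal.ofReal_lt_coe_iff (hEnt_pos h0.le h1).le] at hs1
  have hspos : (0 : ℝ) < s := (hEnt_pos h0.le h1).trans hs
  have h3 : 0 < Real.log 3 := Real.log_pos (by norm_num)
  set q := (1 - p) / 2 with hq
  have hq0 : 0 < q := by rw [hq]; linarith
  set w : ℕ → ℕ → ℝ := fun n j => p ^ onesCount j * q ^ (n - onesCount j) with hw
  set good : ℕ → ℕ → Prop := fun n j =>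
    j < 3 ^ n ∧ Real.exp (-(n * (Real.log 3 * hEnt p))) ≤ w n j with hgood
  set x := Real.exp (Real.log 3 * (hEnt p - s)) with hx
  have hx1 : x < 1 := by
    rw [hx, Real.exp_lt_one_iff]; exact mul_neg_of_pos_of_neg h3 (by linarith)
  classical
  let t : ℕ → ℕ × ℕ → Set ℝ := fun N nj =>
    if N ≤ nj.1 ∧ good nj.1 nj.2 then Icc ((nj.2 : ℝ) / 3 ^ nj.1) ((1 + nj.2) / 3 ^ nj.1) else ∅
  have hdiam (N n j : ℕ) : Metric.ediam (t N (n, j)) ≤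
      if N ≤ n ∧ good n j then ENNReal.ofReal ((1 / 3) ^ n) else 0 := by
    simp only [t]
    split_ifs
    · rw [Real.ediam_Icc]; refine le_of_eq ?_; congr 1
      rw [← sub_div, add_sub_cancel_right, one_div_pow]
    · simp
  refine dimH_le_of_hausdorffMeasure_ne_top (ne_top_of_le_ne_top ?_
    ((Measure.hausdorffMeasure_le_liminf_tsum (β := ℕ) (ι := fun _ => ℕ × ℕ) (s : ℝ) (heavySet p)
      (l := atTop) (fun N => ENNReal.ofReal ((1 / 3) ^ N)) ?_ t ?_ ?_).trans
      (liminf_le_of_le (a := ∑' n : ℕ, ENNReal.ofReal (x ^ n)) (by isBoundedDefault) ?_)))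
  · exact (summable_geometric_of_lt_one (Real.exp_pos _).le hx1).tsum_ofReal_ne_top
  · rw [← ENNReal.ofReal_zero]
    exact ENNReal.tendsto_ofReal (tendsto_pow_atTop_nhds_zero_of_lt_one (by norm_num) (by norm_num))
  · refine Eventually.of_forall fun N => ?_
    rintro ⟨n, j⟩
    refine (hdiam N n j).trans ?_
    split_ifs with h
    · exact ENNReal.ofReal_le_ofReal (pow_le_pow_of_le_one (by norm_num) (by norm_num) h.1)
    · exact zero_le
  · refine Eventually.of_forall fun N => ?_
    rintro y ⟨hy, hfr⟩
    obtain ⟨n, hn, hle⟩ := (frequently_atTop.mp hfr) N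
    obtain ⟨hj, u, u0, u1, hu⟩ := floor_triadic hy.1.le hy.2 n
    refine mem_iUnion.mpr ⟨(n, ⌊(3 : ℝ) ^ n * y⌋₊), ?_⟩
    simp only [t]
    rw [if_pos ⟨hn, hj, hle⟩]
    generalize ⌊(3 : ℝ) ^ n * y⌋₊ = j at *
    rw [hu]
    constructor
    · gcongr; linarith
    · gcongr
  · intro b hb
    obtain ⟨N, hN⟩ := (eventually_atTop.mp hb)
    refine (hN N le_rfl).trans ?_
    refine (ENNReal.tsum_prod (f := fun n j => Metric.ediam (t N (n, j)) ^ (s : ℝ))).le.trans ?_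
    refine ENNReal.tsum_le_tsum fun n => ?_
    have hterm (j : ℕ) : Metric.ediam (t N (n, j)) ^ (s : ℝ) ≤
        if j < 3 ^ n then ENNReal.ofReal (x ^ n * w n j) else 0 := by
      refine (ENNReal.rpow_le_rpow (hdiam N n j) hspos.le).trans ?_
      by_cases h : N ≤ n ∧ good n j
      · rw [if_pos h, if_pos h.2.1, ENNReal.ofReal_rpow_of_pos (by positivity)]
        refine ENNReal.ofReal_le_ofReal ?_
        have e1 : (((1 : ℝ) / 3) ^ n) ^ (s : ℝ) = Real.exp (-(n * (Real.log 3 * s))) := by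
          rw [Real.rpow_def_of_pos (by positivity), Real.log_pow, one_div, Real.log_inv]
          congr 1; ring
        have e2 : x ^ n = Real.exp (n * (Real.log 3 * hEnt p)) * Real.exp (-(n * (Real.log 3 * s))) := by
          rw [hx, ← Real.exp_nat_mul, ← Real.exp_add]; congr 1; ring
        have e3 : 1 ≤ Real.exp (n * (Real.log 3 * hEnt p)) * w n j := by
          have := mul_le_mul_of_nonneg_left h.2.2 (Real.exp_pos (n * (Real.log 3 * hEnt p))).le
          rwa [← Real.exp_add, add_neg_cancel, Real.exp_zero] at this
        rw [e1, e2]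
        calc _ ≤ (Real.exp (n * (Real.log 3 * hEnt p)) * w n j) * Real.exp (-(n * (Real.log 3 * s))) :=
              le_mul_of_one_le_left (Real.exp_pos _).le e3
          _ = _ := by ring
      · rw [if_neg h, ENNReal.zero_rpow_of_pos hspos]; exact zero_le
    refine (ENNReal.tsum_le_tsum hterm).trans (le_of_eq ?_)
    rw [tsum_eq_sum (s := Finset.range (3 ^ n)) (fun j hj => if_neg (by simpa using hj)),
      Finset.sum_congr rfl (fun j hj => if_pos (Finset.mem_range.mp hj)),
      ← ENNReal.ofReal_sum_of_nonneg (fun j _ => by positivity), ← Finset.mul_sum,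
      sum_pow_onesCount, show p + 2 * q = 1 by rw [hq]; ring, one_pow, mul_one]

lemma eventually_of_notMem_heavySet {p : ℝ} (h0 : 0 < p) (h1 : p < 1) {x : ℝ} (hx : x ∈ Ioo (0 : ℝ) 1)
    (h : x ∉ heavySet p) : ∀ᶠ n : ℕ in atTop,
      ((onesCount ⌊(3 : ℝ) ^ n * x⌋₊ : ℝ) - p * n) * (Real.log p - Real.log ((1 - p) / 2)) < 0 := by
  have hq : 0 < (1 - p) / 2 := by linarith
  have h' : ∀ᶠ n : ℕ in atTop, ¬ (Real.exp (-(n * (Real.log 3 * hEnt p))) ≤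
      p ^ onesCount ⌊(3 : ℝ) ^ n * x⌋₊ * ((1 - p) / 2) ^ (n - onesCount ⌊(3 : ℝ) ^ n * x⌋₊)) := by
    rw [← not_frequently]; exact fun hf => h ⟨hx, hf⟩
  filter_upwards [h'] with n hn
  have hl := onesCount_le (floor_triadic hx.1.le hx.2 n).1
  generalize onesCount ⌊(3 : ℝ) ^ n * x⌋₊ = l at *
  rw [not_le, ← Real.log_lt_iff_lt_exp (by positivity), Real.log_mul (by positivity) (by positivity),
    Real.log_pow, Real.log_pow, log_three_mul_hEnt h1, Nat.cast_sub hl] at hn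
  linarith

lemma tendsto_pow_mul_pow_of_eventually {A ρ p : ℝ} {l : ℕ → ℕ} (hA : 0 < A) (hρ : 0 < ρ)
    (h : A * ρ ^ p < 1) (hl : ∀ᶠ n in atTop, ρ ^ (l n : ℝ) ≤ ρ ^ (p * n)) :
    Tendsto (fun n => A ^ n * ρ ^ l n) atTop (𝓝 0) := by
  refine tendsto_of_tendsto_of_tendsto_of_le_of_le' tendsto_const_nhds
    (tendsto_pow_atTop_nhds_zero_of_lt_one (by positivity) h)
    (Eventually.of_forall fun n => by positivity) ?_
  filter_upwards [hl] with n hn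
  rw [mul_pow, ← Real.rpow_natCast (ρ ^ p), ← Real.rpow_mul hρ.le, ← Real.rpow_natCast ρ (l n)]
  gcongr

/-- Points of `(0,1)` at which `M_{k,a}` does not have derivative zero have many ternary
prefixes of large Bernoulli mass. -/
lemma diff_zero_subset_heavySet {a p : ℝ} (ha : 0 < a) (ha1 : a < 1) (k : ℕ) (h0 : 0 < p) (h1 : p < 1)
    (hp : 3 * a * (|1 - 2 * a| / a) ^ p < 1)
    (hside : p < 1 / 3 ∧ |1 - 2 * a| < a ∨ 1 / 3 < p ∧ a < |1 - 2 * a|) :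
    Ioo (0 : ℝ) 1 \ {x ∈ Ioo (0 : ℝ) 1 | HasDerivAt (Mfun k a) 0 x} ⊆ heavySet p := by
  rintro x ⟨hx, hxD⟩
  by_contra hxh
  refine hxD ⟨hx, ?_⟩
  have hq : 0 < (1 - p) / 2 := by linarith
  have hev := eventually_of_notMem_heavySet h0 h1 hx hxh
  have habs : |1 - 2 * a| < 1 := by rw [abs_lt]; constructor <;> linarith
  have cA : ContinuousAt (fun r : ℝ => 3 * (a + r)) 0 := by fun_prop
  have cρ : ContinuousAt (fun r : ℝ => (|1 - 2 * a| + 2 * r) / (a + r)) 0 :=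
    ContinuousAt.div (by fun_prop) (by fun_prop) (by simpa using ha.ne')
  have e1 : ∀ᶠ r in 𝓝[>] (0 : ℝ), 3 * (a + r) * ((|1 - 2 * a| + 2 * r) / (a + r)) ^ p < 1 :=
    ((cA.mul (cρ.rpow_const (Or.inr h0.le))).eventually_lt_const (by simpa using hp)).filter_mono
      nhdsWithin_le_nhds
  have c2 : ContinuousAt (fun r : ℝ => a + r) 0 := by fun_prop
  have c3 : ContinuousAt (fun r : ℝ => |1 - 2 * a| + 2 * r) 0 := by fun_prop
  have e2 : ∀ᶠ r in 𝓝[>] (0 : ℝ), a + r < 1 :=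
    (c2.eventually_lt_const (by simpa using ha1)).filter_mono nhdsWithin_le_nhds
  have e3 : ∀ᶠ r in 𝓝[>] (0 : ℝ), |1 - 2 * a| + 2 * r < 1 :=
    (c3.eventually_lt_const (by simpa using habs)).filter_mono nhdsWithin_le_nhds
  have e0 : ∀ᶠ r in 𝓝[>] (0 : ℝ), 0 < r := eventually_mem_nhdsWithin
  rcases hside with ⟨hs, hs'⟩ | ⟨hs, hs'⟩
  · have e4 : ∀ᶠ r in 𝓝[>] (0 : ℝ), (|1 - 2 * a| + 2 * r) / (a + r) < 1 :=
      (cρ.eventually_lt_const (by simpa using (div_lt_one ha).mpr hs')).filter_mono nhdsWithin_le_nhds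
    obtain ⟨r, hr, e1, e2, e3, e4⟩ := (e0.and (e1.and (e2.and (e3.and e4)))).exists
    refine hasDerivAt_Mfun_zero ha hr e2 e3 k hx (tendsto_pow_mul_pow_of_eventually (by positivity)
      (by positivity) e1 ?_)
    filter_upwards [hev] with n hn
    have hlog : Real.log p - Real.log ((1 - p) / 2) < 0 :=
      sub_neg.mpr (Real.log_lt_log h0 (by linarith))
    refine Real.rpow_le_rpow_of_exponent_ge (by positivity) e4.le ?_
    nlinarith
  · have e4 : ∀ᶠ r in 𝓝[>] (0 : ℝ), 1 < (|1 - 2 * a| + 2 * r) / (a + r) :=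
      (cρ.eventually_const_lt (by simpa using (one_lt_div ha).mpr hs')).filter_mono nhdsWithin_le_nhds
    obtain ⟨r, hr, e1, e2, e3, e4⟩ := (e0.and (e1.and (e2.and (e3.and e4)))).exists
    refine hasDerivAt_Mfun_zero ha hr e2 e3 k hx (tendsto_pow_mul_pow_of_eventually (by positivity)
      (by positivity) e1 ?_)
    filter_upwards [hev] with n hn
    have hlog : 0 < Real.log p - Real.log ((1 - p) / 2) :=
      sub_pos.mpr (Real.log_lt_log hq (by linarith))
    refine Real.rpow_le_rpow_of_exponent_le e4.le ?_
    nlinarith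

lemma mul_sq_mul_abs_lt_one {a₀ a : ℝ} (ha₀ : 54 * a₀ ^ 3 - 27 * a₀ ^ 2 = 1) (ha : 0 < a)
    (ha' : a < a₀) (ha'' : a ≠ 1 / 3) : a < 1 ∧ 27 * a ^ 2 * |1 - 2 * a| < 1 := by
  have hlt : a₀ < 1 := by
    by_contra h
    nlinarith [mul_nonneg (sub_nonneg.mpr (not_lt.mp h)) (sq_nonneg a₀)]
  refine ⟨ha'.trans hlt, ?_⟩
  rcases le_total a (1 / 2) with h | h
  · rw [abs_of_nonneg (by linarith)]
    have : 0 < (a - 1 / 3) ^ 2 := by have := sub_ne_zero.mpr ha''; positivity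
    nlinarith
  · rw [abs_of_nonpos (by linarith)]
    have : a ^ 2 * (2 * a - 1) < a₀ ^ 2 * (2 * a₀ - 1) := by
      refine mul_lt_mul'' ?_ (by linarith) (by positivity) (by linarith)
      gcongr
    nlinarith

lemma phiOk_spec {a : ℝ} (ha : 0 < a) (ha1 : a < 1) (h : 27 * a ^ 2 * |1 - 2 * a| < 1)
    (h3 : a ≠ 1 / 3) (h2 : a ≠ 1 / 2) :
    0 < phiOk a ∧ phiOk a < 1 ∧
    (∀ p, Real.log (3 * a) + p * (Real.log |1 - 2 * a| - Real.log a) =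
      (p - phiOk a) * (Real.log |1 - 2 * a| - Real.log a)) ∧
    (Real.log |1 - 2 * a| - Real.log a < 0 ∧ phiOk a < 1 / 3 ∨
      0 < Real.log |1 - 2 * a| - Real.log a ∧ 1 / 3 < phiOk a) := by
  have hb : 0 < |1 - 2 * a| := abs_pos.mpr (by intro h; apply h2; linarith)
  have hl := Real.log_neg (by positivity) h
  have hl3 : Real.log (3 * a) = Real.log 3 + Real.log a := Real.log_mul (by norm_num) ha.ne'
  have h27 : Real.log 27 = 3 * Real.log 3 := by
    rw [show (27 : ℝ) = 3 ^ 3 by norm_num, Real.log_pow]; norm_num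
  rw [Real.log_mul (by positivity) hb.ne', Real.log_mul (by norm_num) (by positivity), Real.log_pow,
    h27] at hl
  rw [phiOk, if_neg h3, if_neg h2]
  push_cast at hl
  rcases lt_or_gt_of_ne h3 with h | h
  · have hab : |1 - 2 * a| = 1 - 2 * a := abs_of_nonneg (by linarith)
    have hlam : Real.log a - Real.log |1 - 2 * a| < 0 :=
      sub_neg.mpr (Real.log_lt_log ha (by rw [hab]; linarith))
    have hl0 : Real.log (3 * a) < 0 := Real.log_neg (by positivity) (by linarith)
    have h1 : 0 < Real.log 3 + Real.log |1 - 2 * a| := by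
      rw [← Real.log_mul (by norm_num) hb.ne']
      exact Real.log_pos (by rw [hab]; linarith)
    refine ⟨div_pos_of_neg_of_neg hl0 hlam, (div_lt_one_of_neg hlam).mpr (by linarith), ?_,
      Or.inr ⟨by linarith, (lt_div_iff_of_neg hlam).mpr (by linarith)⟩⟩
    intro p
    linear_combination -div_mul_cancel₀ (Real.log (3 * a)) hlam.ne
  · have hab : |1 - 2 * a| < a := abs_lt.mpr ⟨by linarith, by linarith⟩
    have hlam : 0 < Real.log a - Real.log |1 - 2 * a| := sub_pos.mpr (Real.log_lt_log hb hab)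
    have hl0 : 0 < Real.log (3 * a) := Real.log_pos (by linarith)
    have hlt : Real.log (3 * a) / (Real.log a - Real.log |1 - 2 * a|) < 1 / 3 :=
      (div_lt_iff₀ hlam).mpr (by linarith)
    refine ⟨div_pos hl0 hlam, by linarith, ?_, Or.inl ⟨by linarith, hlt⟩⟩
    intro p
    linear_combination -div_mul_cancel₀ (Real.log (3 * a)) hlam.ne'

lemma phiOk_half : phiOk (1 / 2) = 0 := by
  rw [phiOk, if_neg (by norm_num), if_pos rfl]

lemma phiOk_mem {a : ℝ} (ha : 0 < a) (ha1 : a < 1) (h : 27 * a ^ 2 * |1 - 2 * a| < 1)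
    (h3 : a ≠ 1 / 3) : 0 ≤ phiOk a ∧ phiOk a < 1 ∧ phiOk a ≠ 1 / 3 := by
  by_cases h2 : a = 1 / 2
  · rw [h2, phiOk_half]; norm_num
  · obtain ⟨e1, e2, -, e3⟩ := phiOk_spec ha ha1 h h3 h2
    refine ⟨e1.le, e2, ?_⟩
    rcases e3 with e | e
    · exact e.2.ne
    · exact e.2.ne'

lemma dimH_diff_zero_le {a : ℝ} (ha : 0 < a) (ha1 : a < 1) (h : 27 * a ^ 2 * |1 - 2 * a| < 1)
    (h3 : a ≠ 1 / 3) (k : ℕ) :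
    dimH (Ioo (0 : ℝ) 1 \ {x ∈ Ioo (0 : ℝ) 1 | HasDerivAt (Mfun k a) 0 x}) ≤
      ENNReal.ofReal (dOk a) := by
  have key (s : Set ℝ) [hs : (𝓝[s] phiOk a).NeBot] (hev : ∀ᶠ p in 𝓝[s] phiOk a, 0 < p ∧ p < 1 ∧
      3 * a * (|1 - 2 * a| / a) ^ p < 1 ∧
      (p < 1 / 3 ∧ |1 - 2 * a| < a ∨ 1 / 3 < p ∧ a < |1 - 2 * a|)) :
      dimH (Ioo (0 : ℝ) 1 \ {x ∈ Ioo (0 : ℝ) 1 | HasDerivAt (Mfun k a) 0 x}) ≤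
        ENNReal.ofReal (dOk a) := by
    have ht : Tendsto (fun p => ENNReal.ofReal (hEnt p)) (𝓝[s] phiOk a) (𝓝 (ENNReal.ofReal (dOk a))) :=
      ENNReal.tendsto_ofReal (continuous_hEnt.continuousAt.tendsto.mono_left nhdsWithin_le_nhds)
    refine ge_of_tendsto ht ?_
    filter_upwards [hev] with p hp
    exact (dimH_mono (diff_zero_subset_heavySet ha ha1 k hp.1 hp.2.1 hp.2.2.1 hp.2.2.2)).trans
      (dimH_heavySet_le hp.1 hp.2.1)
  by_cases h2 : a = 1 / 2
  · have hphi : phiOk a = 0 := by rw [h2, phiOk_half]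
    refine key (Ioi (phiOk a)) ?_
    rw [hphi]
    filter_upwards [Ioo_mem_nhdsGT (show (0 : ℝ) < 1 / 3 by norm_num)] with p hp
    have : |1 - 2 * a| = 0 := by rw [h2]; norm_num
    rw [this]
    refine ⟨hp.1, by linarith [hp.2], ?_, Or.inl ⟨hp.2, ha⟩⟩
    rw [zero_div, Real.zero_rpow hp.1.ne']
    norm_num
  · obtain ⟨e1, e2, eq, e3⟩ := phiOk_spec ha ha1 h h3 h2
    have hb : 0 < |1 - 2 * a| := abs_pos.mpr (by intro h; apply h2; linarith)
    have hrw (p : ℝ) : 3 * a * (|1 - 2 * a| / a) ^ p =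
        Real.exp ((p - phiOk a) * (Real.log |1 - 2 * a| - Real.log a)) := by
      rw [← eq, Real.exp_add, Real.exp_log (by positivity), Real.rpow_def_of_pos (by positivity),
        Real.log_div hb.ne' ha.ne', mul_comm p]
    rcases e3 with ⟨hl, hp⟩ | ⟨hl, hp⟩
    · refine key (Ioi (phiOk a)) ?_
      filter_upwards [Ioo_mem_nhdsGT hp] with p hp
      refine ⟨e1.trans hp.1, by linarith [hp.2], ?_,
        Or.inl ⟨hp.2, (Real.log_lt_log_iff hb ha).mp (by linarith)⟩⟩
      rw [hrw, Real.exp_lt_one_iff]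
      exact mul_neg_of_pos_of_neg (sub_pos.mpr hp.1) hl
    · refine key (Iio (phiOk a)) ?_
      filter_upwards [Ioo_mem_nhdsLT hp] with p hp
      refine ⟨by linarith [hp.1], by linarith [hp.2], ?_,
        Or.inr ⟨hp.1, (Real.log_lt_log_iff ha hb).mp (by linarith)⟩⟩
      rw [hrw, Real.exp_lt_one_iff]
      exact mul_neg_of_neg_of_pos (sub_neg.mpr hp.2) hl

lemma ae_hasDerivAt_Mfun {a : ℝ} (ha : 0 < a) (ha1 : a < 1) (h : 27 * a ^ 2 * |1 - 2 * a| < 1)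
    (h3 : a ≠ 1 / 3) (k : ℕ) :
    ∀ᵐ x ∂(volume.restrict (Ioo (0 : ℝ) 1)), ∃ d : ℝ, HasDerivAt (Mfun k a) d x := by
  obtain ⟨p0, p1, p3⟩ := phiOk_mem ha ha1 h h3
  have hd : dimH (Ioo (0 : ℝ) 1 \ {x ∈ Ioo (0 : ℝ) 1 | HasDerivAt (Mfun k a) 0 x}) <
      ((1 : NNReal) : ℝ≥0∞) := by
    refine (dimH_diff_zero_le ha ha1 h h3 k).trans_lt ?_
    rw [ENNReal.coe_one, ENNReal.ofReal_lt_one]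
    exact hEnt_lt_one p0 p1 p3
  have h0 := hausdorffMeasure_of_dimH_lt hd
  rw [NNReal.coe_one, hausdorffMeasure_real] at h0
  rw [ae_restrict_iff' measurableSet_Ioo, ae_iff]
  refine measure_mono_null ?_ h0
  intro x hx
  simp only [mem_ofPred_eq, Classical.not_imp] at hx
  exact ⟨hx.1, fun hxd => hx.2 ⟨0, hxd.2⟩⟩

/-- If points coded by words over `K` letters are separated in the sense that words first
differing at position `j` are coded by points at distance at least `c * K ^ (-j / r)`, then the
coded set has Hausdorff dimension at least `r`. -/
lemma ofReal_le_dimH_range {K : ℕ} (hK : 1 < K) {X : (ℕ → Fin K) → ℝ} {C r : ℝ} (hC : 0 ≤ C)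
    (hr : 0 < r) (h : ∀ ω ω' j, (∀ i < j, ω i = ω' i) → ω j ≠ ω' j →
      ((K : ℝ) ^ j)⁻¹ ≤ C * |X ω - X ω'| ^ r) :
    ENNReal.ofReal r ≤ dimH (range X) := by
  have : NeZero K := ⟨by omega⟩
  have hdist (ω ω' : ℕ → Fin K) : |Real.ofDigits ω - Real.ofDigits ω'| ≤ C * |X ω - X ω'| ^ r := by
    by_cases he : ω = ω'
    · subst he; simp only [sub_self, abs_zero]; positivity
    · have hex : ∃ j, ω j ≠ ω' j := Function.ne_iff.mp he
      classical
      refine le_trans ?_ (h ω ω' (Nat.find hex) (fun i hi => not_not.mp (Nat.find_min hex hi))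
        (Nat.find_spec hex))
      exact Real.abs_ofDigits_sub_ofDigits_le fun i hi => not_not.mp (Nat.find_min hex hi)
  set g : ℝ → ℝ := fun x => Real.ofDigits (Function.invFun X x) with hg
  have hgX (ω : ℕ → Fin K) : g (X ω) = Real.ofDigits ω := by
    have := hdist (Function.invFun X (X ω)) ω
    rw [Function.invFun_eq (f := X) ⟨ω, rfl⟩, sub_self, abs_zero, Real.zero_rpow hr.ne', mul_zero] at this
    exact sub_eq_zero.mp (abs_nonpos_iff.mp this)
  have hH : HolderOnWith C.toNNReal r.toNNReal g (range X) := by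
    rintro _ ⟨ω, rfl⟩ _ ⟨ω', rfl⟩
    rw [hgX, hgX, edist_dist, edist_dist, Real.dist_eq, Real.dist_eq, Real.coe_toNNReal _ hr.le,
      ENNReal.ofReal_rpow_of_nonneg (abs_nonneg _) hr.le, ← ENNReal.ofReal.eq_1,
      ← ENNReal.ofReal_mul hC]
    exact ENNReal.ofReal_le_ofReal (hdist ω ω')
  have himg : Icc (0 : ℝ) 1 ⊆ g '' range X := by
    intro y hy
    obtain ⟨ω, -, rfl⟩ := Real.ofDigits_SurjOn hK hy
    exact ⟨X ω, ⟨ω, rfl⟩, hgX ω⟩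
  have h1 : dimH (Icc (0 : ℝ) 1) = 1 := by
    rw [Real.dimH_of_nonempty_interior (by simp)]; simp
  have h2 := (dimH_mono himg).trans (hH.dimH_image_le (Real.toNNReal_pos.mpr hr))
  rw [h1] at h2
  have hr0 : ENNReal.ofReal r ≠ 0 := by simpa using hr
  have := (ENNReal.le_div_iff_mul_le (Or.inl hr0) (Or.inl ENNReal.ofReal_ne_top)).mp h2
  simpa using this

/-- The natural number written with the first `n` digits of `D` in base `B`. -/
def digitPrefix {B : ℕ} (D : ℕ → Fin B) : ℕ → ℕ
  | 0 => 0
  | n + 1 => B * digitPrefix D n + D n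

lemma digitPrefix_lt {B : ℕ} (D : ℕ → Fin B) (n : ℕ) : digitPrefix D n < B ^ n := by
  induction n with
  | zero => simp [digitPrefix]
  | succ n ih =>
    rw [digitPrefix, pow_succ']
    calc _ < B * digitPrefix D n + B := by have := (D n).2; omega
      _ = B * (digitPrefix D n + 1) := by ring
      _ ≤ B * B ^ n := Nat.mul_le_mul_left _ ih

lemma ofDigits_eq_digitPrefix {B : ℕ} (D : ℕ → Fin B) (n : ℕ) :
    Real.ofDigits D = (digitPrefix D n + Real.ofDigits fun i => D (i + n)) / (B : ℝ) ^ n := by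
  have hB : (B : ℝ) ≠ 0 := by exact_mod_cast (Fin.pos (D 0)).ne'
  rw [Real.ofDigits_eq_sum_add_ofDigits D n]
  have : ∑ i ∈ Finset.range n, Real.ofDigitsTerm D i = digitPrefix D n / (B : ℝ) ^ n := by
    induction n with
    | zero => simp [digitPrefix]
    | succ n ih =>
      rw [Finset.sum_range_succ, ih, digitPrefix, Real.ofDigitsTerm]
      push_cast
      field_simp
      ring
  rw [this]
  ring

lemma digitPrefix_congr {B : ℕ} {D D' : ℕ → Fin B} {n : ℕ} (h : ∀ i < n, D i = D' i) :
    digitPrefix D n = digitPrefix D' n := by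
  induction n with
  | zero => rfl
  | succ n ih =>
    rw [digitPrefix, digitPrefix, ih fun i hi => h i (by omega), h n (by omega)]

lemma inv_pow_le_ofDigits_sub {B : ℕ} {D D' : ℕ → Fin B} {n : ℕ} (h : ∀ i < n, D i = D' i)
    (hn : (D n : ℕ) + 2 ≤ D' n) :
    ((B : ℝ) ^ (n + 1))⁻¹ ≤ Real.ofDigits D' - Real.ofDigits D := by
  have hB : (0 : ℝ) < B := by exact_mod_cast Fin.pos (D 0)
  rw [ofDigits_eq_digitPrefix D (n + 1), ofDigits_eq_digitPrefix D' (n + 1), digitPrefix, digitPrefix,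
    digitPrefix_congr h, ← sub_div, inv_eq_one_div]
  have h0 := Real.ofDigits_nonneg fun i => D' (i + (n + 1))
  have h1 := Real.ofDigits_le_one fun i => D (i + (n + 1))
  have h2 : (D n : ℝ) + 2 ≤ D' n := by exact_mod_cast hn
  gcongr
  push_cast
  linarith

lemma inv_pow_le_abs_ofDigits_sub {B : ℕ} {D D' : ℕ → Fin B} {n : ℕ} (h : ∀ i < n, D i = D' i)
    (hn : (D n : ℕ) + 2 ≤ D' n ∨ (D' n : ℕ) + 2 ≤ D n) :
    ((B : ℝ) ^ (n + 1))⁻¹ ≤ |Real.ofDigits D - Real.ofDigits D'| := by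
  rcases hn with hn | hn
  · rw [abs_sub_comm]
    exact (inv_pow_le_ofDigits_sub h hn).trans (le_abs_self _)
  · exact (inv_pow_le_ofDigits_sub (fun i hi => (h i hi).symm) hn).trans (le_abs_self _)

/-- `[u, v]` is a nondegenerate subinterval of `[0, 1]` of length less than `δ` around `x`. -/
def IsBracket (x δ u v : ℝ) : Prop := 0 ≤ u ∧ u ≤ x ∧ x ≤ v ∧ v ≤ 1 ∧ u < v ∧ v - u < δ

lemma exists_forall_isBracket_le {f : ℝ → ℝ} {x c : ℝ}
    (h : ∀ᶠ y in 𝓝[Icc 0 1 \ {x}] x, c ≤ (f y - f x) / (y - x)) :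
    ∃ δ > 0, ∀ u v, IsBracket x δ u v → c * (v - u) ≤ f v - f u := by
  rw [eventually_nhdsWithin_iff, Metric.eventually_nhds_iff] at h
  obtain ⟨δ, hδ, h⟩ := h
  refine ⟨δ, hδ, ?_⟩
  rintro u v ⟨h0, hux, hxv, h1, -, hd⟩
  have e1 : c * (v - x) ≤ f v - f x := by
    rcases hxv.eq_or_lt with rfl | hxv
    · simp
    · have := h (y := v) (by rw [Real.dist_eq, abs_lt]; constructor <;> linarith)
        ⟨⟨by linarith, h1⟩, hxv.ne'⟩
      rwa [le_div_iff₀ (by linarith)] at this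
  have e2 : c * (x - u) ≤ f x - f u := by
    rcases hux.eq_or_lt with rfl | hux
    · simp
    · have := h (y := u) (by rw [Real.dist_eq, abs_lt]; constructor <;> linarith)
        ⟨⟨h0, by linarith⟩, hux.ne⟩
      rw [le_div_iff_of_neg (by linarith)] at this
      linarith
  linarith

lemma exists_forall_isBracket_ge {f : ℝ → ℝ} {x c : ℝ}
    (h : ∀ᶠ y in 𝓝[Icc 0 1 \ {x}] x, (f y - f x) / (y - x) ≤ c) :
    ∃ δ > 0, ∀ u v, IsBracket x δ u v → f v - f u ≤ c * (v - u) := by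
  obtain ⟨δ, hδ, H⟩ := exists_forall_isBracket_le (f := fun y => -f y) (x := x) (c := -c) (by
    filter_upwards [h] with y hy
    rw [← neg_sub', neg_div]
    exact neg_le_neg hy)
  exact ⟨δ, hδ, fun u v huv => by have := H u v huv; linarith⟩

lemma not_exists_hasDerivAt_of_isBracket {f : ℝ → ℝ} {x : ℝ}
    (h : ∀ C, ∀ δ > 0, ∃ u v, IsBracket x δ u v ∧ C * (v - u) < |f v - f u|) :
    ¬ ∃ d, HasDerivAt f d x := by
  rintro ⟨d, hd⟩
  have ht : Tendsto (fun y => (f y - f x) / (y - x)) (𝓝[Icc 0 1 \ {x}] x) (𝓝 d) := by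
    have := hasDerivAt_iff_tendsto_slope.mp hd
    simp only [slope_fun_def_field] at this
    exact this.mono_left (nhdsWithin_mono x fun y hy => hy.2)
  obtain ⟨δ₁, h₁, H₁⟩ := exists_forall_isBracket_le (ht.eventually_const_le (sub_one_lt d))
  obtain ⟨δ₂, h₂, H₂⟩ := exists_forall_isBracket_ge (ht.eventually_le_const (lt_add_one d))
  obtain ⟨u, v, huv, hlt⟩ := h (|d| + 1) (min δ₁ δ₂) (lt_min h₁ h₂)
  have e1 := H₁ u v ⟨huv.1, huv.2.1, huv.2.2.1, huv.2.2.2.1, huv.2.2.2.2.1,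
    huv.2.2.2.2.2.trans_le (min_le_left _ _)⟩
  have e2 := H₂ u v ⟨huv.1, huv.2.1, huv.2.2.1, huv.2.2.2.1, huv.2.2.2.2.1,
    huv.2.2.2.2.2.trans_le (min_le_right _ _)⟩
  have hpos : 0 < v - u := sub_pos.mpr huv.2.2.2.2.1
  refine hlt.not_ge (abs_le.mpr ⟨?_, ?_⟩)
  · nlinarith [neg_abs_le d]
  · nlinarith [le_abs_self d]

lemma not_derivPInf_of_isBracket {f : ℝ → ℝ} {x : ℝ}
    (h : ∀ δ > 0, ∃ u v, IsBracket x δ u v ∧ f v - f u < v - u) : ¬ derivPInf f x := by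
  intro ht
  obtain ⟨δ, hδ, H⟩ := exists_forall_isBracket_le (ht.eventually_ge_atTop 1)
  obtain ⟨u, v, huv, hlt⟩ := h δ hδ
  have := H u v huv
  linarith

lemma not_derivMInf_of_isBracket {f : ℝ → ℝ} {x : ℝ}
    (h : ∀ δ > 0, ∃ u v, IsBracket x δ u v ∧ -(v - u) < f v - f u) : ¬ derivMInf f x := by
  intro ht
  obtain ⟨δ, hδ, H⟩ := exists_forall_isBracket_ge (ht.eventually_le_atBot (-1))
  obtain ⟨u, v, huv, hlt⟩ := h δ hδ
  have := H u v huv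
  linarith

lemma tendsto_descFactorial_div_pow {m n : ℕ → ℕ} {c : ℝ} (hn : Tendsto n atTop atTop) (i : ℕ)
    (h : Tendsto (fun t => (m t : ℝ) / n t) atTop (𝓝 c)) (hm : Tendsto m atTop atTop) :
    Tendsto (fun t => ((m t).descFactorial i : ℝ) / (n t : ℝ) ^ i) atTop (𝓝 (c ^ i)) := by
  induction i with
  | zero => simp
  | succ i ih =>
    have h1 : Tendsto (fun t => (m t : ℝ) / n t - i / n t) atTop (𝓝 (c - 0)) :=
      h.sub ((tendsto_const_div_atTop_nhds_zero_nat (i : ℝ)).comp hn)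
    rw [sub_zero] at h1
    rw [pow_succ']
    refine (h1.mul ih).congr' ?_
    filter_upwards [hm.eventually_ge_atTop i] with t ht
    rw [Nat.descFactorial_succ, Nat.cast_mul, Nat.cast_sub ht]
    ring

lemma tendsto_natCast_atTop_of_div {m n : ℕ → ℕ} {c : ℝ} (hc : 0 < c) (hn : Tendsto n atTop atTop)
    (h : Tendsto (fun t => (m t : ℝ) / n t) atTop (𝓝 c)) : Tendsto m atTop atTop := by
  rw [← tendsto_natCast_atTop_iff (R := ℝ)]
  refine (h.pos_mul_atTop hc (tendsto_natCast_atTop_iff.mpr hn)).congr' ?_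
  filter_upwards [hn.eventually_gt_atTop 0] with t ht
  field_simp

/-- Leading order of the `k`-th derivative of `b ^ (n - l) * (1 - 2 * b) ^ l`. -/
lemma tendsto_iteratedDeriv_slope_div {a p : ℝ} (ha : a ≠ 0) (ha2 : 1 - 2 * a ≠ 0) (hp0 : 0 < p)
    (hp1 : p < 1) (k : ℕ) {n l : ℕ → ℕ} (hn : Tendsto n atTop atTop) (hl : ∀ t, l t ≤ n t)
    (h : Tendsto (fun t => (l t : ℝ) / n t) atTop (𝓝 p)) :
    Tendsto (fun t => iteratedDeriv k (fun b : ℝ => b ^ (n t - l t) * (1 - 2 * b) ^ l t) a /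
      ((n t : ℝ) ^ k * (a ^ (n t - l t) * (1 - 2 * a) ^ l t))) atTop
      (𝓝 (((1 - p) / a + -2 * p / (1 - 2 * a)) ^ k)) := by
  have hm : Tendsto (fun t => ((n t - l t : ℕ) : ℝ) / n t) atTop (𝓝 (1 - p)) := by
    refine (h.const_sub 1).congr' ?_
    filter_upwards [hn.eventually_gt_atTop 0] with t ht
    rw [Nat.cast_sub (hl t)]
    field_simp
  have hlt := tendsto_natCast_atTop_of_div hp0 hn h
  have hmt := tendsto_natCast_atTop_of_div (sub_pos.mpr hp1) hn hm
  rw [add_pow]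
  have hsum : Tendsto (fun t => ∑ i ∈ Finset.range (k + 1),
      (((n t - l t).descFactorial i : ℝ) / (n t : ℝ) ^ i / a ^ i) *
      (((l t).descFactorial (k - i) : ℝ) / (n t : ℝ) ^ (k - i) * ((-2) / (1 - 2 * a)) ^ (k - i)) *
      (k.choose i : ℝ)) atTop (𝓝 (∑ i ∈ Finset.range (k + 1),
      (((1 - p) ^ i / a ^ i) * (p ^ (k - i) * ((-2) / (1 - 2 * a)) ^ (k - i)) * (k.choose i : ℝ)))) :=
    tendsto_finsetSum _ fun i _ =>
      (((tendsto_descFactorial_div_pow hn i hm hmt).div_const _).mul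
        ((tendsto_descFactorial_div_pow hn (k - i) h hlt).mul_const _)).mul_const _
  refine (hsum.congr' ?_).trans_eq ?_
  · filter_upwards [hn.eventually_gt_atTop 0, hlt.eventually_ge_atTop k, hmt.eventually_ge_atTop k]
      with t ht hlk hmk
    rw [iteratedDeriv_slope, Finset.sum_div]
    refine Finset.sum_congr rfl fun i hi => ?_
    have hik : i ≤ k := Nat.lt_succ_iff.mp (Finset.mem_range.mp hi)
    have hn0 : (n t : ℝ) ≠ 0 := by exact_mod_cast ht.ne'
    rw [pow_sub₀ a ha (hik.trans hmk), pow_sub₀ (1 - 2 * a) ha2 ((Nat.sub_le k i).trans hlk),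
      show (n t : ℝ) ^ k = (n t : ℝ) ^ i * (n t : ℝ) ^ (k - i) by rw [← pow_add]; congr 1; omega,
      div_pow]
    field_simp
  · congr 1
    refine Finset.sum_congr rfl fun i hi => ?_
    rw [div_pow (1 - p) a, ← mul_pow p, show p * (-2 / (1 - 2 * a)) = -2 * p / (1 - 2 * a) by ring]

lemma three_pow_mul_abs_slope {a : ℝ} (ha : 0 < a) (ha2 : 1 - 2 * a ≠ 0) {n l : ℕ} (hn : 0 < n)
    (hl : l ≤ n) : 3 ^ n * |a ^ (n - l) * (1 - 2 * a) ^ l| =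
      Real.exp (n * (Real.log (3 * a) + (l / n : ℝ) * (Real.log |1 - 2 * a| - Real.log a))) := by
  have hb := abs_pos.mpr ha2
  have hn0 : (n : ℝ) ≠ 0 := by exact_mod_cast hn.ne'
  have : (n : ℝ) * (Real.log (3 * a) + (l / n : ℝ) * (Real.log |1 - 2 * a| - Real.log a)) =
      n * Real.log 3 + ((n - l : ℕ) * Real.log a + l * Real.log |1 - 2 * a|) := by
    rw [Real.log_mul (by norm_num) ha.ne', Nat.cast_sub hl]
    field_simp
    ring
  rw [this, Real.exp_add, Real.exp_add, Real.exp_nat_mul, Real.exp_nat_mul, Real.exp_nat_mul,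
    Real.exp_log ha, Real.exp_log hb, Real.exp_log (by norm_num), abs_mul, abs_pow, abs_pow,
    abs_of_pos ha]

lemma abs_three_pow_mul_iteratedDeriv_eventuallyEq {a : ℝ} (ha : 0 < a) (ha2 : 1 - 2 * a ≠ 0) (k : ℕ)
    {n l : ℕ → ℕ} (hn : Tendsto n atTop atTop) (hl : ∀ t, l t ≤ n t) :
    (fun t => |iteratedDeriv k (fun b : ℝ => b ^ (n t - l t) * (1 - 2 * b) ^ l t) a /
      ((n t : ℝ) ^ k * (a ^ (n t - l t) * (1 - 2 * a) ^ l t))| * ((n t : ℝ) ^ k *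
      Real.exp (n t * (Real.log (3 * a) + (l t / n t : ℝ) * (Real.log |1 - 2 * a| - Real.log a)))))
    =ᶠ[atTop] fun t => |3 ^ n t *
      iteratedDeriv k (fun b : ℝ => b ^ (n t - l t) * (1 - 2 * b) ^ l t) a| := by
  filter_upwards [hn.eventually_gt_atTop 0] with t ht
  have hn0 : (0 : ℝ) < n t := by exact_mod_cast ht
  rw [← three_pow_mul_abs_slope ha ha2 ht (hl t), abs_div, abs_mul ((n t : ℝ) ^ k),
    abs_of_pos (pow_pos hn0 k), abs_mul (3 ^ n t : ℝ), abs_of_pos (show (0 : ℝ) < 3 ^ n t by positivity)]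
  have : |a ^ (n t - l t) * (1 - 2 * a) ^ l t| ≠ 0 := by positivity
  field_simp

lemma tendsto_abs_slope_atTop {a p : ℝ} (ha : 0 < a) (ha2 : 1 - 2 * a ≠ 0) (hp0 : 0 < p)
    (hp1 : p < 1) (k : ℕ) {n l : ℕ → ℕ} (hn : Tendsto n atTop atTop) (hl : ∀ t, l t ≤ n t)
    (h : Tendsto (fun t => (l t : ℝ) / n t) atTop (𝓝 p))
    (hθ : 0 < Real.log (3 * a) + p * (Real.log |1 - 2 * a| - Real.log a))
    (hc : (1 - p) / a + -2 * p / (1 - 2 * a) ≠ 0) :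
    Tendsto (fun t => |3 ^ n t *
      iteratedDeriv k (fun b : ℝ => b ^ (n t - l t) * (1 - 2 * b) ^ l t) a|) atTop atTop := by
  refine Tendsto.congr' (abs_three_pow_mul_iteratedDeriv_eventuallyEq ha ha2 k hn hl) ?_
  refine Tendsto.pos_mul_atTop (abs_pos.mpr (pow_ne_zero k hc))
    (tendsto_iteratedDeriv_slope_div ha.ne' ha2 hp0 hp1 k hn hl h).abs ?_
  set θ := Real.log (3 * a) + p * (Real.log |1 - 2 * a| - Real.log a)
  have hy := (h.mul_const (Real.log |1 - 2 * a| - Real.log a)).const_add (Real.log (3 * a))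
  have hexp : Tendsto (fun t => Real.exp (n t * (θ / 2))) atTop atTop :=
    Real.tendsto_exp_atTop.comp
      ((tendsto_natCast_atTop_iff.mpr hn).atTop_mul_const (half_pos hθ))
  refine tendsto_atTop_mono' _ ?_ hexp
  filter_upwards [hn.eventually_gt_atTop 0, hy.eventually_const_le (half_lt_self hθ)] with t ht hyt
  have h1 : (1 : ℝ) ≤ (n t : ℝ) ^ k := one_le_pow₀ (by exact_mod_cast ht)
  refine le_trans ?_ (le_mul_of_one_le_left (Real.exp_pos _).le h1)
  gcongr

lemma tendsto_abs_slope_zero {a p : ℝ} (ha : 0 < a) (ha2 : 1 - 2 * a ≠ 0) (hp0 : 0 < p)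
    (hp1 : p < 1) (k : ℕ) {n l : ℕ → ℕ} (hn : Tendsto n atTop atTop) (hl : ∀ t, l t ≤ n t)
    (h : Tendsto (fun t => (l t : ℝ) / n t) atTop (𝓝 p))
    (hθ : Real.log (3 * a) + p * (Real.log |1 - 2 * a| - Real.log a) < 0) :
    Tendsto (fun t => |3 ^ n t *
      iteratedDeriv k (fun b : ℝ => b ^ (n t - l t) * (1 - 2 * b) ^ l t) a|) atTop (𝓝 0) := by
  refine Tendsto.congr' (abs_three_pow_mul_iteratedDeriv_eventuallyEq ha ha2 k hn hl) ?_
  rw [← mul_zero |((1 - p) / a + -2 * p / (1 - 2 * a)) ^ k|]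
  refine Tendsto.mul (tendsto_iteratedDeriv_slope_div ha.ne' ha2 hp0 hp1 k hn hl h).abs ?_
  set θ := Real.log (3 * a) + p * (Real.log |1 - 2 * a| - Real.log a)
  have hy := (h.mul_const (Real.log |1 - 2 * a| - Real.log a)).const_add (Real.log (3 * a))
  have hexp : Tendsto (fun t => (n t : ℝ) ^ k * Real.exp (θ / 2) ^ n t) atTop (𝓝 0) :=
    (tendsto_pow_const_mul_const_pow_of_abs_lt_one k (by
      rw [abs_of_pos (Real.exp_pos _), Real.exp_lt_one_iff]; linarith)).comp hn
  refine tendsto_of_tendsto_of_tendsto_of_le_of_le' tendsto_const_nhds hexp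
    (Eventually.of_forall fun t => by positivity) ?_
  filter_upwards [hy.eventually_le_const (show θ < θ / 2 by linarith)] with t hyt
  rw [← Real.exp_nat_mul]
  gcongr

lemma onesCount_pow_mul_add (n J : ℕ) {j : ℕ} (hj : j < 3 ^ n) :
    onesCount (3 ^ n * J + j) = onesCount J + onesCount j := by
  induction n generalizing j with
  | zero =>
    obtain rfl : j = 0 := by simpa using hj
    simp [onesCount_zero]
  | succ n ih =>
    obtain ⟨j', d, hd, rfl⟩ := exists_eq_three_mul_add j
    rw [show 3 ^ (n + 1) * J + (3 * j' + d) = 3 * (3 ^ n * J + j') + d by ring,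
      onesCount_three_mul_add _ hd, onesCount_three_mul_add _ hd, ih (by rw [pow_succ] at hj; omega)]
    ring

lemma isBracket_digitPrefix {b : ℕ} (D : ℕ → Fin (3 ^ b)) (T : ℕ) {δ : ℝ}
    (hδ : (1 / 3 : ℝ) ^ (b * T) < δ) :
    IsBracket (Real.ofDigits D) δ (digitPrefix D T / 3 ^ (b * T))
      ((1 + digitPrefix D T) / 3 ^ (b * T)) := by
  have hlt := digitPrefix_lt D T
  rw [← pow_mul] at hlt
  have hlt' : (digitPrefix D T : ℝ) + 1 ≤ 3 ^ (b * T) := by exact_mod_cast hlt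
  have heq := ofDigits_eq_digitPrefix D T
  push_cast at heq
  rw [← pow_mul] at heq
  have h0 := Real.ofDigits_nonneg fun i => D (i + T)
  have h1 := Real.ofDigits_le_one fun i => D (i + T)
  have h3 : (0 : ℝ) < 3 ^ (b * T) := by positivity
  refine ⟨by positivity, ?_, ?_, ?_, ?_, ?_⟩
  · rw [heq]; gcongr; linarith
  · rw [heq]; gcongr ?_ / _; linarith
  · rw [div_le_one h3]; linarith
  · gcongr; linarith
  · rwa [← sub_div, add_sub_cancel_right, ← one_div_pow]

/-- Points of `(0,1)` at which `f` has neither a finite nor an infinite derivative. -/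
def nonDiffSet (f : ℝ → ℝ) : Set ℝ :=
  {x ∈ Ioo (0:ℝ) 1 | ¬ (∃ d : ℝ, HasDerivAt f d x) ∧ ¬ derivPInf f x ∧ ¬ derivMInf f x}

lemma dimH_range_le_of_mem_Icc {ι : Type*} {X : ι → ℝ} {f : ℝ → ℝ} (hX : ∀ ω, X ω ∈ Icc (0 : ℝ) 1)
    (h : ∀ ω, X ω ∈ Ioo (0 : ℝ) 1 → X ω ∈ nonDiffSet f) : dimH (range X) ≤ dimH (nonDiffSet f) := by
  have hsub : range X ⊆ nonDiffSet f ∪ {0, 1} := by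
    rintro _ ⟨ω, rfl⟩
    obtain ⟨h0, h1⟩ := hX ω
    rcases h0.eq_or_lt with h0 | h0
    · exact Or.inr (Or.inl h0.symm)
    · rcases h1.eq_or_lt with h1 | h1
      · exact Or.inr (Or.inr h1)
      · exact Or.inl (h ω ⟨h0, h1⟩)
  refine (dimH_mono hsub).trans ?_
  rw [dimH_union, (Set.toFinite {(0 : ℝ), 1}).dimH_zero]
  simp

/-- The index of the doubly exponential scale `[2 ^ 2 ^ s, 2 ^ 2 ^ (s + 1))` containing `j`. -/
def scaleIndex (j : ℕ) : ℕ := Nat.log 2 (Nat.log 2 j)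

lemma scaleIndex_eq {s j : ℕ} (h : 2 ^ 2 ^ s ≤ j) (h' : j < 2 ^ 2 ^ (s + 1)) : scaleIndex j = s := by
  have hj : j ≠ 0 := (lt_of_lt_of_le (by positivity) h).ne'
  have h1 : 2 ^ s ≤ Nat.log 2 j := Nat.le_log_of_pow_le (by norm_num) h
  have h2 : Nat.log 2 j < 2 ^ (s + 1) := Nat.log_lt_of_lt_pow hj h'
  exact Nat.log_eq_of_pow_le_of_lt_pow h1 h2

lemma tendsto_sum_scaleIndex (m : ℕ → ℕ) {L M b : ℕ} {s : ℕ → ℕ} (hs : Tendsto s atTop atTop)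
    (hm : ∀ i, m i ≤ L) (hM : M ≤ L) (hsM : ∀ i, m (s i) = M) :
    Tendsto (fun i => ((∑ j ∈ Finset.range (2 ^ 2 ^ (s i + 1)), m (scaleIndex j) : ℕ) : ℝ) /
      (b * 2 ^ 2 ^ (s i + 1) : ℕ)) atTop (𝓝 ((M : ℝ) / b)) := by
  have hS (i : ℕ) : (2 : ℕ) ^ 2 ^ (i + 1) = 2 ^ 2 ^ i * 2 ^ 2 ^ i := by rw [← pow_add]; congr 1; ring
  have key (i : ℕ) : |((∑ j ∈ Finset.range (2 ^ 2 ^ (s i + 1)), m (scaleIndex j) : ℕ) : ℝ) /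
      2 ^ 2 ^ (s i + 1) - (M : ℝ)| ≤ (L : ℝ) / 2 ^ 2 ^ s i := by
    have e1 : ((∑ j ∈ Finset.range (2 ^ 2 ^ (s i + 1)), m (scaleIndex j) : ℕ) : ℝ) -
        M * 2 ^ 2 ^ (s i + 1) = ∑ j ∈ Finset.range (2 ^ 2 ^ s i), ((m (scaleIndex j) : ℝ) - M) := by
      have : ((∑ j ∈ Finset.range (2 ^ 2 ^ (s i + 1)), m (scaleIndex j) : ℕ) : ℝ) -
          M * 2 ^ 2 ^ (s i + 1) =
          ∑ j ∈ Finset.range (2 ^ 2 ^ (s i + 1)), ((m (scaleIndex j) : ℝ) - M) := by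
        rw [Finset.sum_sub_distrib]; simp [mul_comm]
      rw [this]
      refine (Finset.sum_subset (Finset.range_mono (Nat.pow_le_pow_right (by norm_num)
        (Nat.pow_le_pow_right (by norm_num) (Nat.le_succ _)))) fun j hj hj' => ?_).symm
      rw [scaleIndex_eq (not_lt.mp (by simpa using hj')) (by simpa using hj), hsM, sub_self]
    have e2 : |∑ j ∈ Finset.range (2 ^ 2 ^ s i), ((m (scaleIndex j) : ℝ) - M)| ≤
        2 ^ 2 ^ s i * L := by
      refine (Finset.abs_sum_le_sum_abs _ _).trans ((Finset.sum_le_card_nsmul _ _ (L : ℝ) ?_).trans_eq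
        (by simp))
      intro j _
      have h1 : (m (scaleIndex j) : ℝ) ≤ L := by exact_mod_cast hm _
      have h2 : (M : ℝ) ≤ L := by exact_mod_cast hM
      rw [abs_le]
      constructor <;> linarith [(m (scaleIndex j)).cast_nonneg (α := ℝ), M.cast_nonneg (α := ℝ)]
    rw [← e1] at e2
    have hpos : (0 : ℝ) < 2 ^ 2 ^ s i := by positivity
    have hS' : (2 : ℝ) ^ 2 ^ (s i + 1) = 2 ^ 2 ^ s i * 2 ^ 2 ^ s i := by exact_mod_cast hS (s i)
    rw [div_sub' (by positivity), abs_div, abs_of_pos (a := (2 : ℝ) ^ 2 ^ (s i + 1)) (by positivity),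
      mul_comm _ (M : ℝ), div_le_div_iff₀ (by positivity) (by positivity)]
    calc _ ≤ 2 ^ 2 ^ s i * (L : ℝ) * 2 ^ 2 ^ s i := by gcongr
      _ = _ := by rw [hS']; ring
  have hlim : Tendsto (fun i => (L : ℝ) / 2 ^ 2 ^ s i) atTop (𝓝 0) := by
    refine Tendsto.const_div_atTop ?_ _
    have h2 : Tendsto (fun n : ℕ => (2 : ℕ) ^ n) atTop atTop :=
      tendsto_pow_atTop_atTop_of_one_lt (by norm_num)
    have := (tendsto_pow_atTop_atTop_of_one_lt (one_lt_two (α := ℝ))).comp (h2.comp hs)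
    exact this
  have h1 := (tendsto_iff_norm_sub_tendsto_zero (b := (M : ℝ))).mpr
    (squeeze_zero (fun i => norm_nonneg _) key hlim)
  refine (h1.div_const (b : ℝ)).congr fun i => ?_
  push_cast
  rw [div_div, mul_comm (b : ℝ)]

/-- The words of length `L` over `{0, 1, 2}` with exactly `m` letters `1`, as base 3 numbers. -/
def wordsWithOnes (L m : ℕ) : Finset ℕ := (Finset.range (3 ^ L)).filter fun w => onesCount w = m

lemma mem_wordsWithOnes {L m w : ℕ} : w ∈ wordsWithOnes L m ↔ w < 3 ^ L ∧ onesCount w = m := by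
  simp [wordsWithOnes]

/-- Alternating on doubly exponential scales between blocks with digit frequencies on the two sides
of the critical one produces points without finite or infinite derivative. -/
lemma ofReal_le_dimH_nonDiffSet {a : ℝ} (ha : 0 < a) (ha1 : a < 1) (ha2 : 1 - 2 * a ≠ 0) (k : ℕ)
    {L K : ℕ} {m : ℕ → ℕ} (hK : 1 < K) (hm : ∀ i, 0 < m i ∧ m i ≤ L)
    (hcard : ∀ i, K ≤ (wordsWithOnes L (m i)).card)
    {sA sB : ℕ → ℕ} (hsA : Tendsto sA atTop atTop) (hsB : Tendsto sB atTop atTop)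
    {mA mB : ℕ} (hmA : ∀ i, m (sA i) = mA) (hmB : ∀ i, m (sB i) = mB)
    (hθA : 0 < Real.log (3 * a) + mA / (L + 1 : ℕ) * (Real.log |1 - 2 * a| - Real.log a))
    (hcA : (1 - (mA : ℝ) / (L + 1 : ℕ)) / a + -2 * ((mA : ℝ) / (L + 1 : ℕ)) / (1 - 2 * a) ≠ 0)
    (hθB : Real.log (3 * a) + mB / (L + 1 : ℕ) * (Real.log |1 - 2 * a| - Real.log a) < 0) :
    ENNReal.ofReal (Real.log K / ((L + 1 : ℕ) * Real.log 3)) ≤ dimH (nonDiffSet (Mfun k a)) := by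
  have hex (i : ℕ) : ∃ e : Fin K → ℕ, Function.Injective e ∧ ∀ c, e c ∈ wordsWithOnes L (m i) := by
    obtain ⟨s, hs, hsc⟩ := Finset.exists_subset_card_eq (hcard i)
    exact ⟨s.orderEmbOfFin hsc, (s.orderEmbOfFin hsc).injective,
      fun c => hs (s.orderEmbOfFin_mem hsc c)⟩
  choose e he hemem using hex
  simp only [mem_wordsWithOnes] at hemem
  let D (ω : ℕ → Fin K) (j : ℕ) : Fin (3 ^ (L + 1)) :=
    ⟨3 * e (scaleIndex j) (ω j), by rw [pow_succ]; have := (hemem (scaleIndex j) (ω j)).1; omega⟩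
  have hones (ω : ℕ → Fin K) (T : ℕ) : onesCount (digitPrefix (D ω) T) =
      ∑ j ∈ Finset.range T, m (scaleIndex j) := by
    induction T with
    | zero => simp [digitPrefix, onesCount_zero]
    | succ T ih =>
      rw [digitPrefix, onesCount_pow_mul_add _ _ (D ω T).2, ih, Finset.sum_range_succ]
      have := onesCount_three_mul_add (e (scaleIndex T) (ω T)) (d := 0) (by norm_num)
      simp only [D, add_zero, zero_ne_one, if_false] at this ⊢
      rw [this, (hemem _ _).2]
  set n : ℕ → ℕ := fun s => (L + 1) * 2 ^ 2 ^ (s + 1) with hn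
  set l : ℕ → ℕ := fun s => ∑ j ∈ Finset.range (2 ^ 2 ^ (s + 1)), m (scaleIndex j) with hl
  have hln (s : ℕ) : l s ≤ n s := by
    refine (Finset.sum_le_card_nsmul _ _ L fun j _ => (hm _).2).trans ?_
    simp only [Finset.card_range, smul_eq_mul, hn]
    rw [mul_comm]
    gcongr
    omega
  have hnt : Tendsto n atTop atTop := by
    have h2 : Tendsto (fun n : ℕ => (2 : ℕ) ^ n) atTop atTop :=
      tendsto_pow_atTop_atTop_of_one_lt (by norm_num)
    refine tendsto_atTop_mono (fun s => ?_) (h2.comp (h2.comp (tendsto_add_atTop_nat 1)))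
    exact Nat.le_mul_of_pos_left _ (by omega)
  have hp {M : ℕ} (h0 : 0 < M) (hML : M ≤ L) : 0 < (M : ℝ) / (L + 1 : ℕ) ∧
      (M : ℝ) / (L + 1 : ℕ) < 1 := by
    refine ⟨by positivity, (div_lt_one (by positivity)).mpr ?_⟩
    exact_mod_cast Nat.lt_succ_of_le hML
  obtain ⟨hA0, hAL⟩ : 0 < mA ∧ mA ≤ L := hmA 0 ▸ hm _
  obtain ⟨hB0, hBL⟩ : 0 < mB ∧ mB ≤ L := hmB 0 ▸ hm _
  have hA := tendsto_abs_slope_atTop ha ha2 (hp hA0 hAL).1 (hp hA0 hAL).2 k (hnt.comp hsA)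
    (fun t => hln (sA t))
    (tendsto_sum_scaleIndex m (b := L + 1) hsA (fun i => (hm i).2) hAL hmA) hθA hcA
  have hB := tendsto_abs_slope_zero ha ha2 (hp hB0 hBL).1 (hp hB0 hBL).2 k (hnt.comp hsB)
    (fun t => hln (sB t))
    (tendsto_sum_scaleIndex m (b := L + 1) hsB (fun i => (hm i).2) hBL hmB) hθB
  have hsmall {δ : ℝ} (hδ : 0 < δ) : ∀ᶠ s in atTop, (1 / 3 : ℝ) ^ n s < δ :=
    ((tendsto_pow_atTop_nhds_zero_of_lt_one (by norm_num) (by norm_num)).comp hnt).eventually_lt_const hδ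
  have hslope (ω : ℕ → Fin K) (s : ℕ) : ∃ u v : ℝ, v - u = (3 ^ n s)⁻¹ ∧
      Mfun k a v - Mfun k a u =
        iteratedDeriv k (fun b : ℝ => b ^ (n s - l s) * (1 - 2 * b) ^ l s) a ∧
      ∀ δ, (1 / 3 : ℝ) ^ n s < δ → IsBracket (Real.ofDigits (D ω)) δ u v := by
    refine ⟨digitPrefix (D ω) (2 ^ 2 ^ (s + 1)) / 3 ^ n s,
      (1 + digitPrefix (D ω) (2 ^ 2 ^ (s + 1))) / 3 ^ n s, ?_, ?_, fun δ hδ => ?_⟩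
    · rw [← sub_div, add_sub_cancel_right, one_div]
    · have hlt := digitPrefix_lt (D ω) (2 ^ 2 ^ (s + 1))
      rw [← pow_mul] at hlt
      rw [Mfun_sub_triadic ha ha1 k hlt, hones]
    · exact isBracket_digitPrefix (D ω) _ hδ
  refine le_trans ?_ (dimH_range_le_of_mem_Icc (X := fun ω => Real.ofDigits (D ω))
    (fun ω => ⟨Real.ofDigits_nonneg _, Real.ofDigits_le_one _⟩) fun ω hω => ⟨hω, ?_, ?_, ?_⟩)
  · have h3 : 0 < Real.log 3 := Real.log_pos (by norm_num)
    have hK1 : (1 : ℝ) < K := by exact_mod_cast hK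
    have hr : 0 < Real.log K / ((L + 1 : ℕ) * Real.log 3) :=
      div_pos (Real.log_pos hK1) (by positivity)
    refine ofReal_le_dimH_range hK (C := K) (by positivity) hr fun ω ω' j hj hne => ?_
    have hsep := inv_pow_le_abs_ofDigits_sub (D := D ω) (D' := D ω') (n := j)
      (fun i hi => by simp only [D, hj i hi]) (by
        have := (he (scaleIndex j)).ne hne
        simp only [D]
        omega)
    have hBr : (((3 ^ (L + 1) : ℕ) : ℝ) ^ (j + 1))⁻¹ ^ (Real.log K / ((L + 1 : ℕ) * Real.log 3)) =
        ((K : ℝ) ^ (j + 1))⁻¹ := by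
      push_cast
      rw [← pow_mul, Real.inv_rpow (by positivity), Real.rpow_def_of_pos (by positivity), Real.log_pow,
        ← Real.exp_log (show (0 : ℝ) < K by linarith), ← Real.exp_nat_mul, Real.log_exp]
      congr 2
      push_cast
      field_simp
    have hK0 : (K : ℝ) ≠ 0 := by linarith
    rw [show ((K : ℝ) ^ j)⁻¹ = K * ((K : ℝ) ^ (j + 1))⁻¹ by rw [pow_succ]; field_simp, ← hBr]
    gcongr
  · refine not_exists_hasDerivAt_of_isBracket fun C δ hδ => ?_
    obtain ⟨t, h1, h2⟩ := ((hA.eventually_gt_atTop C).and (hsA.eventually (hsmall hδ))).exists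
    obtain ⟨u, v, huv, hf, hbr⟩ := hslope ω (sA t)
    refine ⟨u, v, hbr δ h2, ?_⟩
    rw [huv, hf]
    simp only [Function.comp_apply, abs_mul, abs_pow, Nat.abs_ofNat] at h1
    rwa [← div_eq_mul_inv, div_lt_iff₀' (by positivity)]
  · refine not_derivPInf_of_isBracket fun δ hδ => ?_
    obtain ⟨t, h1, h2⟩ := ((hB.eventually_lt_const one_pos).and (hsB.eventually (hsmall hδ))).exists
    obtain ⟨u, v, huv, hf, hbr⟩ := hslope ω (sB t)
    refine ⟨u, v, hbr δ h2, ?_⟩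
    rw [huv, hf, ← one_div, lt_div_iff₀' (by positivity)]
    exact (abs_lt.mp h1).2
  · refine not_derivMInf_of_isBracket fun δ hδ => ?_
    obtain ⟨t, h1, h2⟩ := ((hB.eventually_lt_const one_pos).and (hsB.eventually (hsmall hδ))).exists
    obtain ⟨u, v, huv, hf, hbr⟩ := hslope ω (sB t)
    refine ⟨u, v, hbr δ h2, ?_⟩
    rw [huv, hf, ← one_div, ← neg_div, div_lt_iff₀' (by positivity)]
    exact (abs_lt.mp h1).1

lemma card_wordsWithOnes (L m : ℕ) : (wordsWithOnes L m).card = L.choose m * 2 ^ (L - m) := by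
  have hcard (L m : ℕ) : (wordsWithOnes L m).card =
      ∑ w ∈ Finset.range (3 ^ L), if onesCount w = m then 1 else 0 := by
    rw [wordsWithOnes, Finset.card_filter]
  rw [hcard]
  induction L generalizing m with
  | zero =>
    rw [pow_zero, Finset.sum_range_one, onesCount_zero]
    cases m <;> simp
  | succ L ih =>
    rw [pow_succ', sum_range_three_mul]
    have h0 (w : ℕ) : onesCount (3 * w) = onesCount w := by
      simpa using onesCount_three_mul_add w (d := 0) (by norm_num)
    have h1 (w : ℕ) : onesCount (3 * w + 1) = onesCount w + 1 := by
      simpa using onesCount_three_mul_add w (d := 1) (by norm_num)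
    have h2 (w : ℕ) : onesCount (3 * w + 2) = onesCount w := by
      simpa using onesCount_three_mul_add w (d := 2) (by norm_num)
    simp only [h0, h1, h2, Finset.sum_add_distrib, ih]
    cases m with
    | zero => simp; ring
    | succ m =>
      simp only [Nat.add_right_cancel_iff, ih, Nat.choose_succ_succ, Nat.succ_sub_succ]
      rcases Nat.lt_or_ge L (m + 1) with h | h
      · rw [Nat.choose_eq_zero_of_lt h]; simp
      · rw [show L - m = L - (m + 1) + 1 by omega]; ring

/-- The mode of a binomial distribution carries at least the average mass. -/
lemma pow_le_mul_choose_mul_pow {L m : ℕ} (h : m < L) :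
    L ^ L ≤ (L + 1) * (L.choose m * (m ^ m * (L - m) ^ (L - m))) := by
  set T : ℕ → ℕ := fun j => L.choose j * (m ^ j * (L - m) ^ (L - j)) with hT
  have hrec (j : ℕ) (hj : j < L) : T (j + 1) * ((j + 1) * (L - m)) = T j * ((L - j) * m) := by
    have := Nat.choose_succ_right_eq L j
    simp only [hT]
    rw [show L - j = L - (j + 1) + 1 by omega] at this ⊢
    calc _ = (L.choose (j + 1) * (j + 1)) * (m ^ (j + 1) * (L - m) ^ (L - (j + 1)) * (L - m)) := by ring
      _ = _ := by rw [this]; ring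
  have hup (j : ℕ) (hj : j < m) : T j ≤ T (j + 1) := by
    have h1 := hrec j (by omega)
    have hpos : 0 < (j + 1) * (L - m) := by have : 0 < L - m := by omega
                                            positivity
    refine Nat.le_of_mul_le_mul_right ?_ hpos
    rw [h1]
    refine Nat.mul_le_mul_left _ ?_
    rw [mul_comm (L - j)]
    exact Nat.mul_le_mul hj (by omega)
  have hdown (j : ℕ) (hj : m ≤ j) (hjL : j < L) : T (j + 1) ≤ T j := by
    have h1 := hrec j hjL
    have hpos : 0 < (j + 1) * (L - m) := by have : 0 < L - m := by omega
                                            positivity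
    refine Nat.le_of_mul_le_mul_right ?_ hpos
    rw [h1]
    refine Nat.mul_le_mul_left _ ?_
    rw [mul_comm (L - j)]
    exact Nat.mul_le_mul (by omega) (by omega)
  have hmax (j : ℕ) (hj : j ≤ L) : T j ≤ T m := by
    rcases le_total j m with hjm | hjm
    · induction hjm using Nat.decreasingInduction with
      | of_succ i hi ih => exact (hup i hi).trans (ih (by omega))
      | self => exact le_rfl
    · induction j, hjm using Nat.le_induction with
      | base => exact le_rfl
      | succ i hi ih => exact (hdown i hi (by omega)).trans (ih (by omega))
  calc L ^ L = (m + (L - m)) ^ L := by rw [Nat.add_sub_cancel' h.le]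
    _ = ∑ j ∈ Finset.range (L + 1), T j := by
      rw [add_pow]; exact Finset.sum_congr rfl fun j _ => by simp only [hT, Nat.cast_id]; ring
    _ ≤ (L + 1) * T m := by
      simpa using Finset.sum_le_card_nsmul (Finset.range (L + 1)) T (T m)
        fun j hj => hmax j (by simpa [Nat.lt_succ_iff] using hj)

lemma log_card_wordsWithOnes_ge {L m : ℕ} (h0 : 0 < m) (h : m < L) :
    L * (Real.log 3 * hEnt (m / L)) - Real.log (L + 1 : ℕ) ≤
      Real.log (wordsWithOnes L m).card := by
  have hL : (0 : ℝ) < L := by exact_mod_cast (h0.trans h)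
  have hm : (0 : ℝ) < m := by exact_mod_cast h0
  have hLm : (0 : ℝ) < L - m := sub_pos.mpr (by exact_mod_cast h)
  have hp : (m : ℝ) / L < 1 := (div_lt_one hL).mpr (by exact_mod_cast h)
  have hch : 0 < L.choose m := Nat.choose_pos h.le
  have hle : ((L ^ L : ℕ) : ℝ) ≤ ((L + 1) * (L.choose m * (m ^ m * (L - m) ^ (L - m))) : ℕ) :=
    Nat.cast_le.mpr (pow_le_mul_choose_mul_pow h)
  have key := Real.log_le_log (by push_cast; positivity) hle
  push_cast [h.le] at key
  rw [Real.log_pow, Real.log_mul (by positivity) (by positivity),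
    Real.log_mul (by positivity) (by positivity), Real.log_mul (by positivity) (by positivity),
    Real.log_pow, Real.log_pow, Nat.cast_sub h.le] at key
  rw [card_wordsWithOnes, log_three_mul_hEnt hp]
  push_cast
  rw [show (1 - (m : ℝ) / L) / 2 = (L - m) / (L * 2) by field_simp, Real.log_div hm.ne' hL.ne',
    Real.log_div hLm.ne' (by positivity), Real.log_mul hL.ne' (by norm_num),
    Real.log_mul (by positivity) (by positivity), Real.log_pow, Nat.cast_sub h.le]
  have e : (L : ℝ) * -((m : ℝ) / L * (Real.log m - Real.log L) +
      (1 - m / L) * (Real.log (L - m) - (Real.log L + Real.log 2))) =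
      -(m * (Real.log m - Real.log L) + (L - m) * (Real.log (L - m) - (Real.log L + Real.log 2))) := by
    field_simp
  rw [e]
  linarith

lemma tendsto_floor_mul_div_atTop {p : ℝ} (hp : 0 ≤ p) :
    Tendsto (fun L : ℕ => (⌊p * L⌋₊ : ℝ) / L) atTop (𝓝 p) :=
  (tendsto_nat_floor_mul_div_atTop hp).comp tendsto_natCast_atTop_atTop

lemma tendsto_floor_mul_div_succ_atTop {p : ℝ} (hp : 0 ≤ p) :
    Tendsto (fun L : ℕ => (⌊p * L⌋₊ : ℝ) / (L + 1 : ℕ)) atTop (𝓝 p) := by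
  have h := (tendsto_floor_mul_div_atTop hp).mul (tendsto_natCast_div_add_atTop (1 : ℝ))
  rw [mul_one] at h
  refine h.congr' ?_
  filter_upwards [eventually_gt_atTop 0] with L hL
  have : (L : ℝ) ≠ 0 := by exact_mod_cast hL.ne'
  push_cast
  field_simp

lemma eventually_floor_mul_mem_Ioo {p : ℝ} (hp : 0 < p) (hp1 : p < 1) :
    ∀ᶠ L : ℕ in atTop, 0 < ⌊p * L⌋₊ ∧ ⌊p * L⌋₊ < L := by
  have h := tendsto_floor_mul_div_atTop hp.le
  filter_upwards [h.eventually_const_lt hp, h.eventually_lt_const hp1, eventually_gt_atTop 0]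
    with L h0 h1 hL
  have hL' : (0 : ℝ) < L := by exact_mod_cast hL
  constructor
  · by_contra hc
    rw [Nat.pos_iff_ne_zero, not_not] at hc
    simp [hc] at h0
  · exact_mod_cast (div_lt_one hL').mp h1

lemma ofReal_min_hEnt_le_dimH {a : ℝ} (ha : 0 < a) (ha1 : a < 1) (ha2 : 1 - 2 * a ≠ 0) (k : ℕ)
    {p q : ℝ} (hp : 0 < p) (hp1 : p < 1) (hq : 0 < q) (hq1 : q < 1)
    (hθp : 0 < Real.log (3 * a) + p * (Real.log |1 - 2 * a| - Real.log a))
    (hcp : (1 - p) / a + -2 * p / (1 - 2 * a) ≠ 0)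
    (hθq : Real.log (3 * a) + q * (Real.log |1 - 2 * a| - Real.log a) < 0) :
    ENNReal.ofReal (min (hEnt p) (hEnt q)) ≤ dimH (nonDiffSet (Mfun k a)) := by
  have hlog3 : 0 < Real.log 3 := Real.log_pos (by norm_num)
  let g (L : ℕ) : ℝ := (L * (Real.log 3 * min (hEnt ((⌊p * L⌋₊ : ℝ) / L)) (hEnt ((⌊q * L⌋₊ : ℝ) / L))) -
    Real.log (L + 1 : ℕ)) / ((L + 1 : ℕ) * Real.log 3)
  have hg : Tendsto g atTop (𝓝 (min (hEnt p) (hEnt q))) := by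
    have h1 := ((continuous_hEnt.tendsto p).comp (tendsto_floor_mul_div_atTop hp.le)).min
      ((continuous_hEnt.tendsto q).comp (tendsto_floor_mul_div_atTop hq.le))
    have h2 : Tendsto (fun L : ℕ => Real.log (L + 1 : ℕ) / (L + 1 : ℕ)) atTop (𝓝 0) :=
      (Real.isLittleO_log_id_atTop.tendsto_div_nhds_zero.comp
        tendsto_natCast_atTop_atTop).comp (tendsto_add_atTop_nat 1)
    have h3 := ((tendsto_natCast_div_add_atTop (1 : ℝ)).mul h1).sub (h2.div_const (Real.log 3))
    simp only [one_mul, zero_div, sub_zero] at h3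
    refine h3.congr fun L => ?_
    have : ((L : ℝ) + 1) ≠ 0 := by positivity
    simp only [g, Function.comp]
    push_cast
    field_simp
  have hpos : 0 < min (hEnt p) (hEnt q) := lt_min (hEnt_pos hp.le hp1) (hEnt_pos hq.le hq1)
  refine le_of_tendsto ((ENNReal.continuous_ofReal.tendsto _).comp hg) ?_
  have hfp := tendsto_floor_mul_div_succ_atTop hp.le
  have hfq := tendsto_floor_mul_div_succ_atTop hq.le
  have e1 := (tendsto_const_nhds (x := Real.log (3 * a))).add
    (hfp.mul_const (Real.log |1 - 2 * a| - Real.log a))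
  have e2 := (tendsto_const_nhds (x := Real.log (3 * a))).add
    (hfq.mul_const (Real.log |1 - 2 * a| - Real.log a))
  have e3 := ((hfp.const_sub 1).div_const a).add ((hfp.const_mul (-2)).div_const (1 - 2 * a))
  filter_upwards [eventually_floor_mul_mem_Ioo hp hp1, eventually_floor_mul_mem_Ioo hq hq1,
    e1.eventually_const_lt hθp, e2.eventually_lt_const hθq, e3.eventually_ne hcp,
    hg.eventually_const_lt hpos] with L ⟨hA0, hA1⟩ ⟨hB0, hB1⟩ hθA hθB hcA hgL
  set mA := ⌊p * L⌋₊
  set mB := ⌊q * L⌋₊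
  set K := min (wordsWithOnes L mA).card (wordsWithOnes L mB).card with hKdef
  have hden : 0 < ((L + 1 : ℕ) : ℝ) * Real.log 3 := by positivity
  have hlogK : L * (Real.log 3 * min (hEnt ((mA : ℝ) / L)) (hEnt ((mB : ℝ) / L))) -
      Real.log (L + 1 : ℕ) ≤ Real.log K := by
    rcases min_choice (wordsWithOnes L mA).card (wordsWithOnes L mB).card with h | h
    · rw [hKdef, h]
      refine le_trans ?_ (log_card_wordsWithOnes_ge hA0 hA1)
      gcongr
      exact min_le_left _ _
    · rw [hKdef, h]
      refine le_trans ?_ (log_card_wordsWithOnes_ge hB0 hB1)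
      gcongr
      exact min_le_right _ _
  have hgK : g L ≤ Real.log K / ((L + 1 : ℕ) * Real.log 3) :=
    div_le_div_of_nonneg_right hlogK hden.le
  have hK : 1 < K := by
    have h := (div_pos_iff_of_pos_right hden).mp (hgL.trans_le hgK)
    by_contra hc
    have : K = 0 ∨ K = 1 := by omega
    rcases this with h' | h' <;> simp [h'] at h
  refine (ENNReal.ofReal_le_ofReal hgK).trans
    (ofReal_le_dimH_nonDiffSet ha ha1 ha2 k (m := fun i => if Even i then mA else mB) hK ?_ ?_
      (sA := fun i => 2 * i) (sB := fun i => 2 * i + 1) ?_ ?_ (mA := mA) (mB := mB) ?_ ?_ hθA hcA hθB)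
  · intro i
    split_ifs
    exacts [⟨hA0, hA1.le⟩, ⟨hB0, hB1.le⟩]
  · intro i
    split_ifs
    exacts [min_le_left _ _, min_le_right _ _]
  · exact tendsto_atTop_mono (fun i => by simp only [id]; omega) tendsto_id
  · exact tendsto_atTop_mono (fun i => by simp only [id]; omega) tendsto_id
  · intro i; simp
  · intro i; simp

lemma ofReal_dOk_le_dimH_of_tendsto {a : ℝ} (ha : 0 < a) (ha1 : a < 1) (ha2 : 1 - 2 * a ≠ 0) (k : ℕ)
    {l l' : Filter ℝ} [l.NeBot] [l'.NeBot] (hl : l ≤ 𝓝 (phiOk a)) (hl' : l' ≤ 𝓝 (phiOk a))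
    (hθp : ∀ᶠ p in l, 0 < Real.log (3 * a) + p * (Real.log |1 - 2 * a| - Real.log a))
    (hne : ∀ᶠ p in l, p ≠ 1 - 2 * a)
    (hθq : ∀ᶠ q in l', Real.log (3 * a) + q * (Real.log |1 - 2 * a| - Real.log a) < 0)
    (h0 : 0 < phiOk a) (h1 : phiOk a < 1) :
    ENNReal.ofReal (dOk a) ≤ dimH (nonDiffSet (Mfun k a)) := by
  have hp : Tendsto (fun x : ℝ × ℝ => min (hEnt x.1) (hEnt x.2)) (l ×ˢ l') (𝓝 (dOk a)) := by
    have h := ((continuous_hEnt.tendsto (phiOk a)).comp (tendsto_fst.mono_right hl (x := l ×ˢ l'))).min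
      ((continuous_hEnt.tendsto (phiOk a)).comp (tendsto_snd.mono_right hl' (x := l ×ˢ l')))
    rwa [min_self] at h
  refine le_of_tendsto ((ENNReal.continuous_ofReal.tendsto _).comp hp) ?_
  have hI : ∀ᶠ p in 𝓝 (phiOk a), 0 < p ∧ p < 1 := Ioo_mem_nhds h0 h1
  filter_upwards [((hI.filter_mono hl).and (hθp.and hne)).prod_mk ((hI.filter_mono hl').and hθq)]
    with x ⟨⟨⟨hp0, hp1⟩, hθ, hx⟩, ⟨hq0, hq1⟩, hθ'⟩
  refine ofReal_min_hEnt_le_dimH ha ha1 ha2 k hp0 hp1 hq0 hq1 hθ ?_ hθ'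
  intro hc
  rw [div_add_div _ _ ha.ne' ha2, div_eq_zero_iff] at hc
  rcases hc with hc | hc
  · exact hx (by linarith)
  · exact mul_ne_zero ha.ne' ha2 hc

lemma ofReal_dOk_le_dimH_nonDiffSet_of_ne_half {a : ℝ} (ha : 0 < a) (ha1 : a < 1)
    (h : 27 * a ^ 2 * |1 - 2 * a| < 1) (h3 : a ≠ 1 / 3) (h2 : a ≠ 1 / 2) (k : ℕ) :
    ENNReal.ofReal (dOk a) ≤ dimH (nonDiffSet (Mfun k a)) := by
  obtain ⟨h0, h1, hθ, hs⟩ := phiOk_spec ha ha1 h h3 h2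
  have ha2 : 1 - 2 * a ≠ 0 := fun hc => h2 (by linarith)
  have hne {s : Set ℝ} (hs : phiOk a ∉ s) : ∀ᶠ p in 𝓝[s] phiOk a, p ≠ 1 - 2 * a := by
    by_cases he : phiOk a = 1 - 2 * a
    · filter_upwards [self_mem_nhdsWithin] with p hp hpe
      exact hs (by rwa [he, ← hpe])
    · exact eventually_nhdsWithin_of_eventually_nhds (eventually_ne_nhds he)
  rcases hs with ⟨hlam, -⟩ | ⟨hlam, -⟩
  · refine ofReal_dOk_le_dimH_of_tendsto ha ha1 ha2 k (l := 𝓝[<] phiOk a) (l' := 𝓝[>] phiOk a)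
      nhdsWithin_le_nhds nhdsWithin_le_nhds ?_ (hne (by simp)) ?_ h0 h1
    · filter_upwards [self_mem_nhdsWithin] with p hp
      rw [hθ]; exact mul_pos_of_neg_of_neg (sub_neg.mpr hp) hlam
    · filter_upwards [self_mem_nhdsWithin] with p hp
      rw [hθ]; exact mul_neg_of_pos_of_neg (sub_pos.mpr hp) hlam
  · refine ofReal_dOk_le_dimH_of_tendsto ha ha1 ha2 k (l := 𝓝[>] phiOk a) (l' := 𝓝[<] phiOk a)
      nhdsWithin_le_nhds nhdsWithin_le_nhds ?_ (hne (by simp)) ?_ h0 h1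
    · filter_upwards [self_mem_nhdsWithin] with p hp
      rw [hθ]; exact mul_pos (sub_pos.mpr hp) hlam
    · filter_upwards [self_mem_nhdsWithin] with p hp
      rw [hθ]; exact mul_neg_of_neg_of_pos (sub_neg.mpr hp) hlam

lemma Mfun_half_sub_of_onesCount_eq_zero (k : ℕ) {n j : ℕ} (hj : j < 3 ^ n)
    (h : onesCount j = 0) : Mfun k (1 / 2) ((1 + j) / 3 ^ n) - Mfun k (1 / 2) (j / 3 ^ n) =
      n.descFactorial k * (1 / 2) ^ (n - k) := by
  rw [Mfun_sub_triadic (by norm_num) (by norm_num) k hj, h, iteratedDeriv_slope,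
    Finset.sum_eq_single_of_mem k (by simp)]
  · simp
  · intro i hi hik
    have : k - i = k - i - 1 + 1 := by have := Finset.mem_range.mp hi; omega
    rw [this, Nat.zero_descFactorial_succ]
    simp

lemma Mfun_half_sub_of_onesCount_eq_one {k : ℕ} (hk : 1 ≤ k) {n j : ℕ} (hj : j < 3 ^ (n + 1))
    (h : onesCount j = 1) :
    Mfun k (1 / 2) ((1 + j) / 3 ^ (n + 1)) - Mfun k (1 / 2) (j / 3 ^ (n + 1)) =
      -(2 * k * n.descFactorial (k - 1) * (1 / 2) ^ (n - (k - 1))) := by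
  rw [Mfun_sub_triadic (by norm_num) (by norm_num) k hj, h, iteratedDeriv_slope,
    Finset.sum_eq_single_of_mem (k - 1) (by simp)]
  · rw [show k - (k - 1) = 1 by omega, Nat.choose_symm_of_eq_add (show k = (k - 1) + 1 by omega)]
    simp
    ring
  · intro i hi hik
    rcases Nat.lt_or_ge (k - i) 1 with h1 | h1
    · rw [show k - i = 0 by omega]; norm_num
    · rw [Nat.descFactorial_of_lt (show 1 < k - i by have := Finset.mem_range.mp hi; omega)]
      simp

lemma onesCount_digitPrefix_eq_zero {D : ℕ → Fin (3 ^ 1)} (hD : ∀ i, (D i : ℕ) ≠ 1) (T : ℕ) :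
    onesCount (digitPrefix D T) = 0 := by
  induction T with
  | zero => simp [digitPrefix, onesCount_zero]
  | succ T ih =>
    have := onesCount_three_mul_add (digitPrefix D T) (d := D T) (D T).2
    rw [ih, if_neg (hD T)] at this
    exact this

/-- A long run of digits `2` following a digit `0` moves the point close to a triadic interval on
which the increment of `Mfun k (1 / 2)` is comparatively large and negative. -/
lemma exists_isBracket_half {k : ℕ} (hk : 1 ≤ k) {D : ℕ → Fin (3 ^ 1)} (hD : ∀ i, (D i : ℕ) ≠ 1)
    {n m : ℕ} (hkn : k ≤ n + 1) (h0 : (D n : ℕ) = 0) (h2 : ∀ i < m, (D (n + 1 + i) : ℕ) = 2)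
    (hnm : (n + 1 + m) ^ k ≤ 2 ^ m) {δ : ℝ} (hδ : 2 * (1 / 3 : ℝ) ^ (n + 1) < δ) :
    ∃ u v, IsBracket (Real.ofDigits D) δ u v ∧ Mfun k (1 / 2) v - Mfun k (1 / 2) u < v - u := by
  set J := digitPrefix D n with hJ
  have hJlt : J < 3 ^ n := by simpa using digitPrefix_lt D n
  have hpre (i : ℕ) (hi : i ≤ m) : digitPrefix D (n + 1 + i) + 1 = 3 ^ i * (3 * J + 1) := by
    induction i with
    | zero => simp [digitPrefix, h0, hJ]
    | succ i ih =>
      have := ih (by omega)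
      rw [← add_assoc, digitPrefix, h2 i (by omega), pow_succ' 3 i]
      norm_num only
      linarith
  have hP := hpre m le_rfl
  have hPlt : digitPrefix D (n + 1 + m) < 3 ^ (n + 1 + m) := by simpa using digitPrefix_lt D (n + 1 + m)
  set P := digitPrefix D (n + 1 + m) with hPdef
  have hP' : (1 + P : ℝ) / 3 ^ (n + 1 + m) = (1 + (3 * J : ℕ)) / 3 ^ (n + 1) := by
    have : (P : ℝ) + 1 = 3 ^ m * (3 * J + 1) := by exact_mod_cast hP
    rw [pow_add, add_comm, this]
    push_cast
    field_simp
    ring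
  have hle : (1 / 3 : ℝ) ^ (n + 1 + m) ≤ (1 / 3) ^ (n + 1) :=
    pow_le_pow_of_le_one (by norm_num) (by norm_num) (by omega)
  have hpos : (0 : ℝ) < (1 / 3) ^ (n + 1) := by positivity
  have hbr := isBracket_digitPrefix D (n + 1 + m) (δ := δ) (by rw [one_mul]; linarith)
  rw [one_mul, ← hPdef, hP'] at hbr
  obtain ⟨b1, b2, b3, b4, b5, b6⟩ := hbr
  have s1 := Mfun_half_sub_of_onesCount_eq_zero k hPlt (onesCount_digitPrefix_eq_zero hD _)
  rw [hP'] at s1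
  have h31 : 3 * J + 1 < 3 ^ (n + 1) := by rw [pow_succ]; omega
  have ho : onesCount (3 * J + 1) = 1 := by
    rw [onesCount_three_mul_add J (by norm_num), if_pos rfl, onesCount_digitPrefix_eq_zero hD]
  have s2 := Mfun_half_sub_of_onesCount_eq_one hk h31 ho
  have hmid : (((3 * J + 1 : ℕ) : ℝ)) / 3 ^ (n + 1) = (1 + (3 * J : ℕ)) / 3 ^ (n + 1) := by
    push_cast; ring
  rw [hmid] at s2
  have hlen1 : (1 + (3 * J : ℕ) : ℝ) / 3 ^ (n + 1) - P / 3 ^ (n + 1 + m) = (1 / 3) ^ (n + 1 + m) := by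
    rw [← hP', ← sub_div, add_sub_cancel_right, one_div_pow]
  have hlen2 : (1 + (3 * J + 1 : ℕ) : ℝ) / 3 ^ (n + 1) - (1 + (3 * J : ℕ)) / 3 ^ (n + 1) =
      (1 / 3) ^ (n + 1) := by
    push_cast; rw [← sub_div, one_div_pow]; ring
  refine ⟨P / 3 ^ (n + 1 + m), (1 + (3 * J + 1 : ℕ)) / 3 ^ (n + 1), ⟨b1, b2, ?_, ?_, ?_, ?_⟩, ?_⟩
  · linarith
  · rw [div_le_one (by positivity)]
    have : ((3 * J + 1 : ℕ) : ℝ) + 1 ≤ 3 ^ (n + 1) := by exact_mod_cast h31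
    linarith
  · linarith
  · linarith
  · have hd1 : ((n + 1 + m).descFactorial k : ℝ) ≤ 2 ^ m := by
      exact_mod_cast (Nat.descFactorial_le_pow _ _).trans hnm
    have hd2 : (1 : ℝ) ≤ n.descFactorial (k - 1) := by
      exact_mod_cast Nat.pos_of_ne_zero (by rw [Ne, Nat.descFactorial_eq_zero_iff_lt]; omega)
    have hk' : (1 : ℝ) ≤ k := by exact_mod_cast hk
    have e1 : (1 / 2 : ℝ) ^ (n + 1 + m - k) = (1 / 2) ^ (n - (k - 1)) * (1 / 2) ^ m := by
      rw [← pow_add]; congr 1; omega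
    have hq : (0 : ℝ) < (1 / 2) ^ (n - (k - 1)) := by positivity
    have t1 : ((n + 1 + m).descFactorial k : ℝ) * (1 / 2) ^ (n + 1 + m - k) ≤
        (1 / 2) ^ (n - (k - 1)) := by
      rw [e1]
      calc _ ≤ (2 : ℝ) ^ m * ((1 / 2) ^ (n - (k - 1)) * (1 / 2) ^ m) := by gcongr
        _ = (1 / 2) ^ (n - (k - 1)) * (2 * (1 / 2)) ^ m := by rw [mul_pow]; ring
        _ = _ := by norm_num
    have t2 : (1 / 2 : ℝ) ^ (n - (k - 1)) ≤
        2 * k * n.descFactorial (k - 1) * (1 / 2) ^ (n - (k - 1)) := by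
      refine le_mul_of_one_le_left hq.le ?_
      nlinarith
    have : (0 : ℝ) < (1 / 3) ^ (n + 1 + m) := by positivity
    linarith

lemma ofDigits_mem_nonDiffSet_half {k : ℕ} (hk : 1 ≤ k) {D : ℕ → Fin (3 ^ 1)}
    (hD : ∀ i, (D i : ℕ) ≠ 1)
    (h : ∃ᶠ n in atTop, ∃ m, (D n : ℕ) = 0 ∧ (∀ i < m, (D (n + 1 + i) : ℕ) = 2) ∧
      (n + 1 + m) ^ k ≤ 2 ^ m) (hx : Real.ofDigits D ∈ Ioo (0 : ℝ) 1) :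
    Real.ofDigits D ∈ nonDiffSet (Mfun k (1 / 2)) := by
  have hgeom : Tendsto (fun T : ℕ => (1 / 3 : ℝ) ^ T) atTop (𝓝 0) :=
    tendsto_pow_atTop_nhds_zero_of_lt_one (by norm_num) (by norm_num)
  have hslope (T : ℕ) := Mfun_half_sub_of_onesCount_eq_zero k (n := T)
    (by simpa using digitPrefix_lt D T) (onesCount_digitPrefix_eq_zero hD T)
  refine ⟨hx, not_exists_hasDerivAt_of_isBracket fun C δ hδ => ?_,
    not_derivPInf_of_isBracket fun δ hδ => ?_, not_derivMInf_of_isBracket fun δ hδ => ?_⟩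
  · have h32 : Tendsto (fun T : ℕ => (3 / 2 : ℝ) ^ T) atTop atTop :=
      tendsto_pow_atTop_atTop_of_one_lt (by norm_num)
    obtain ⟨T, hT, hTC, hTk⟩ := ((hgeom.eventually_lt_const hδ).and
      ((h32.eventually_gt_atTop C).and (eventually_ge_atTop k))).exists
    have hbr := isBracket_digitPrefix D T (δ := δ) (by rwa [one_mul])
    rw [one_mul] at hbr
    refine ⟨_, _, hbr, ?_⟩
    rw [hslope]
    refine lt_of_lt_of_le ?_ (le_abs_self _)
    have hd : (1 : ℝ) ≤ T.descFactorial k := by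
      exact_mod_cast Nat.pos_of_ne_zero (by rw [Ne, Nat.descFactorial_eq_zero_iff_lt]; omega)
    calc _ = C * (1 / 3) ^ T := by rw [← sub_div, add_sub_cancel_right, one_div_pow]
      _ < (3 / 2) ^ T * (1 / 3) ^ T := by gcongr
      _ = 1 * (1 / 2) ^ T := by rw [← mul_pow]; norm_num
      _ ≤ _ := mul_le_mul hd (pow_le_pow_of_le_one (by norm_num) (by norm_num) (by omega))
        (by positivity) (by positivity)
  · have h2 : Tendsto (fun T : ℕ => 2 * (1 / 3 : ℝ) ^ (T + 1)) atTop (𝓝 0) := by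
      simpa using (hgeom.comp (tendsto_add_atTop_nat 1)).const_mul 2
    obtain ⟨n, ⟨m, h0, h2, hnm⟩, hn, hnk⟩ := (h.and_eventually
      ((h2.eventually_lt_const hδ).and (eventually_ge_atTop k))).exists
    exact exists_isBracket_half hk hD (by omega) h0 h2 hnm hn
  · obtain ⟨T, hT⟩ := (hgeom.eventually_lt_const hδ).exists
    have hbr := isBracket_digitPrefix D T (δ := δ) (by rwa [one_mul])
    rw [one_mul] at hbr
    refine ⟨_, _, hbr, ?_⟩
    rw [hslope]
    have := sub_pos.mpr hbr.2.2.2.2.1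
    exact (neg_lt_zero.mpr this).trans_le (by positivity)

/-- The position of the `j`-th freely chosen ternary digit. -/
def freePos (j : ℕ) : ℕ := j + Nat.log 2 j ^ 3

lemma strictMono_freePos : StrictMono freePos := fun i j h => by
  have : Nat.log 2 i ^ 3 ≤ Nat.log 2 j ^ 3 := Nat.pow_le_pow_left (Nat.log_mono_right h.le) 3
  unfold freePos
  omega

open Classical in
/-- Ternary digits in `{0, 2}` which are free at the positions `freePos j`; each gap between
consecutive free positions carries a digit `0` followed by digits `2`. -/
noncomputable def sparseDigits (ω : ℕ → Fin 2) : ℕ → Fin (3 ^ 1) :=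
  Function.extend freePos (fun j => ⟨2 * ω j, by have := (ω j).2; omega⟩)
    fun n => if ∃ j, n = freePos j + 1 then ⟨0, by norm_num⟩ else ⟨2, by norm_num⟩

lemma sparseDigits_freePos (ω : ℕ → Fin 2) (j : ℕ) :
    (sparseDigits ω (freePos j) : ℕ) = 2 * ω j := by
  rw [sparseDigits, strictMono_freePos.injective.extend_apply]

lemma sparseDigits_ne_one (ω : ℕ → Fin 2) (n : ℕ) : (sparseDigits ω n : ℕ) ≠ 1 := by
  by_cases h : ∃ j, freePos j = n
  · obtain ⟨j, rfl⟩ := h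
    rw [sparseDigits_freePos]
    omega
  · rw [sparseDigits, Function.extend_apply' _ _ _ h]
    split_ifs <;> simp

lemma freePos_ne_of_between {j n : ℕ} (h : freePos j < n) (h' : n < freePos (j + 1)) (i : ℕ) :
    freePos i ≠ n := by
  rintro rfl
  have h1 := strictMono_freePos.lt_iff_lt.mp h
  have h2 := strictMono_freePos.lt_iff_lt.mp h'
  omega

lemma frequently_sparseDigits (ω : ℕ → Fin 2) (k : ℕ) :
    ∃ᶠ n in atTop, ∃ m, (sparseDigits ω n : ℕ) = 0 ∧
      (∀ i < m, (sparseDigits ω (n + 1 + i) : ℕ) = 2) ∧ (n + 1 + m) ^ k ≤ 2 ^ m := by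
  refine frequently_atTop.mpr fun N => ?_
  set i := N + 2 * k + 1 with hi
  set j := 2 ^ (i + 1) - 1 with hj
  have h2i : 2 ^ (i + 1) = 2 * 2 ^ i := pow_succ' 2 i
  have h1i : i < 2 ^ i := Nat.lt_two_pow_self
  have hj1 : j + 1 = 2 ^ (i + 1) := by omega
  have hlog : Nat.log 2 j = i := Nat.log_eq_of_pow_le_of_lt_pow (by omega) (by omega)
  have e1 : freePos j = j + i ^ 3 := by rw [freePos, hlog]
  have e2 : freePos (j + 1) = freePos j + 1 + 1 + (3 * i ^ 2 + 3 * i) := by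
    rw [e1, hj1, freePos, Nat.log_pow (by norm_num), ← hj1]; ring
  refine ⟨freePos j + 1, by omega, 3 * i ^ 2 + 3 * i, ?_, fun l hl => ?_, ?_⟩
  · rw [sparseDigits, Function.extend_apply' _ _ _
      (not_exists.mpr (freePos_ne_of_between (j := j) (by omega) (by omega))), if_pos ⟨j, rfl⟩]
  · have hne : ¬ ∃ j', freePos j + 1 + 1 + l = freePos j' + 1 := by
      rintro ⟨j', h'⟩
      exact freePos_ne_of_between (j := j) (n := freePos j + 1 + l) (by omega) (by omega) j' (by omega)
    rw [sparseDigits, Function.extend_apply' _ _ _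
      (not_exists.mpr (freePos_ne_of_between (j := j) (by omega) (by omega))), if_neg hne]
  · rw [← e2, hj1, freePos, Nat.log_pow (by norm_num)]
    have h3 : (i + 1) ^ 3 ≤ 2 ^ (3 * i + 3) := by
      rw [show 3 * i + 3 = (i + 1) * 3 by ring, pow_mul]
      exact Nat.pow_le_pow_left (by omega) 3
    have h4 : 2 ^ (i + 1) ≤ 2 ^ (3 * i + 3) := Nat.pow_le_pow_right (by norm_num) (by omega)
    calc _ ≤ (2 ^ (3 * i + 4)) ^ k := Nat.pow_le_pow_left (by rw [pow_succ 2 (3 * i + 3)]; omega) k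
      _ = 2 ^ ((3 * i + 4) * k) := (pow_mul _ _ _).symm
      _ ≤ _ := Nat.pow_le_pow_right (by norm_num) (by
        have : 2 * k ≤ i := by omega
        nlinarith)

lemma sparseDigits_congr {ω ω' : ℕ → Fin 2} {j : ℕ} (h : ∀ i < j, ω i = ω' i) {n : ℕ}
    (hn : n < freePos j) : sparseDigits ω n = sparseDigits ω' n := by
  by_cases hex : ∃ i, freePos i = n
  · obtain ⟨i, rfl⟩ := hex
    ext
    rw [sparseDigits_freePos, sparseDigits_freePos, h i (strictMono_freePos.lt_iff_lt.mp hn)]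
  · rw [sparseDigits, sparseDigits, Function.extend_apply' _ _ _ hex,
      Function.extend_apply' _ _ _ hex]

lemma tendsto_freePos_add_one_div : Tendsto (fun j : ℕ => ((freePos j + 1 : ℕ) : ℝ) / j) atTop (𝓝 1) := by
  have hlog : Tendsto (fun j : ℕ => Real.log j ^ 3 / j) atTop (𝓝 0) :=
    (Real.isLittleO_pow_log_id_atTop (n := 3)).tendsto_div_nhds_zero.comp tendsto_natCast_atTop_atTop
  have h2 : Tendsto (fun j : ℕ => (Nat.log 2 j : ℝ) ^ 3 / j) atTop (𝓝 0) := by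
    refine squeeze_zero (fun j => by positivity) (fun j => ?_)
      (by simpa using hlog.const_mul ((Real.log 2 ^ 3)⁻¹))
    have hle : (Nat.log 2 j : ℝ) ≤ Real.log j / Real.log 2 := by
      simpa [Real.logb] using Real.natLog_le_logb j 2
    calc _ ≤ (Real.log j / Real.log 2) ^ 3 / (j : ℝ) := by gcongr
      _ = _ := by rw [div_pow]; ring
  have h3 := (h2.add (tendsto_one_div_atTop_nhds_zero_nat (𝕜 := ℝ))).const_add 1
  simp only [add_zero] at h3
  refine h3.congr' ?_
  filter_upwards [eventually_gt_atTop 0] with j hj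
  have : (j : ℝ) ≠ 0 := by exact_mod_cast hj.ne'
  rw [freePos]
  push_cast
  field_simp
  ring

lemma exists_inv_two_pow_le {r : ℝ} (hr : r < Real.log 2 / Real.log 3) :
    ∃ C, 0 ≤ C ∧ ∀ j : ℕ, ((2 : ℝ) ^ j)⁻¹ ≤ C * (((3 : ℝ) ^ (freePos j + 1))⁻¹) ^ r := by
  have hlog3 : 0 < Real.log 3 := Real.log_pos (by norm_num)
  have hr' : 1 * (r * Real.log 3) < Real.log 2 := by rw [one_mul]; exact (lt_div_iff₀ hlog3).mp hr
  have hev : ∀ᶠ j : ℕ in atTop,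
      ((2 : ℝ) ^ j)⁻¹ / (((3 : ℝ) ^ (freePos j + 1))⁻¹) ^ r ≤ 1 := by
    filter_upwards [(tendsto_freePos_add_one_div.mul_const (r * Real.log 3)).eventually_lt_const hr',
      eventually_gt_atTop 0] with j hj hj0
    have hj' : (0 : ℝ) < j := by exact_mod_cast hj0
    rw [div_mul_eq_mul_div, div_lt_iff₀ hj'] at hj
    rw [div_le_one (by positivity), Real.le_rpow_iff_log_le (by positivity) (by positivity),
      Real.log_inv, Real.log_inv, Real.log_pow, Real.log_pow]
    linarith
  obtain ⟨C, hC⟩ := (isBoundedUnder_of_eventually_le hev).bddAbove_range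
  refine ⟨C, le_trans (by positivity) (hC ⟨0, rfl⟩), fun j => ?_⟩
  rw [← div_le_iff₀ (by positivity)]
  exact hC ⟨j, rfl⟩

lemma ofReal_dOk_half_le_dimH_nonDiffSet {k : ℕ} (hk : 1 ≤ k) :
    ENNReal.ofReal (dOk (1 / 2)) ≤ dimH (nonDiffSet (Mfun k (1 / 2))) := by
  have hd : dOk (1 / 2) = Real.log 2 / Real.log 3 := by
    rw [dOk, phiOk_half]; simp [hEnt]
  have hpos : 0 < Real.log 2 / Real.log 3 :=
    div_pos (Real.log_pos (by norm_num)) (Real.log_pos (by norm_num))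
  rw [hd]
  refine le_of_tendsto (x := 𝓝[<] (Real.log 2 / Real.log 3))
    ((ENNReal.continuous_ofReal.tendsto _).mono_left nhdsWithin_le_nhds) ?_
  filter_upwards [Ioo_mem_nhdsLT hpos] with r ⟨hr0, hr⟩
  obtain ⟨C, hC0, hC⟩ := exists_inv_two_pow_le hr
  refine (ofReal_le_dimH_range (X := fun ω : ℕ → Fin 2 => Real.ofDigits (sparseDigits ω))
    one_lt_two hC0 hr0 fun ω ω' j hlt hne => ?_).trans
    (dimH_range_le_of_mem_Icc (fun ω => ⟨Real.ofDigits_nonneg _, Real.ofDigits_le_one _⟩)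
      fun ω => ofDigits_mem_nonDiffSet_half hk (sparseDigits_ne_one ω) (frequently_sparseDigits ω k))
  have hsep := inv_pow_le_abs_ofDigits_sub (D := sparseDigits ω) (D' := sparseDigits ω')
    (n := freePos j) (fun i hi => sparseDigits_congr hlt hi) (by
      rw [sparseDigits_freePos, sparseDigits_freePos]
      have : (ω j : ℕ) ≠ ω' j := fun h => hne (Fin.ext h)
      omega)
  norm_num only [pow_one, Nat.cast_ofNat] at hsep
  refine le_trans (by exact_mod_cast hC j) (b := C * (((3 : ℝ) ^ (freePos j + 1))⁻¹) ^ r) ?_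
  gcongr

/-- with `a₀` the unique real root of `54a³ - 27a² = 1`, for `k ≥ 1` and
`0 < a < a₀`, `a ≠ 1/3`, `M_{k,a}` is differentiable a.e., and the set `N_{k,a}` of points
with neither a finite nor an infinite derivative satisfies
`dim_H N_{k,a} = dim_H ((0,1) \ D⁰_{k,a}) = d(a) > 0`. -/
theorem stmt8 (a₀ : ℝ) (ha₀ : 54 * a₀ ^ 3 - 27 * a₀ ^ 2 = 1)
    (huniq : ∀ b : ℝ, 54 * b ^ 3 - 27 * b ^ 2 = 1 → b = a₀)
    (k : ℕ) (hk : 1 ≤ k) (a : ℝ) (ha : 0 < a) (ha' : a < a₀) (ha'' : a ≠ 1/3) :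
    (∀ᵐ x ∂(volume.restrict (Set.Ioo (0:ℝ) 1)), ∃ d : ℝ, HasDerivAt (Mfun k a) d x) ∧
    dimH {x ∈ Set.Ioo (0:ℝ) 1 |
        ¬ (∃ d : ℝ, HasDerivAt (Mfun k a) d x) ∧
        ¬ derivPInf (Mfun k a) x ∧ ¬ derivMInf (Mfun k a) x}
      = ENNReal.ofReal (dOk a) ∧
    dimH (Set.Ioo (0:ℝ) 1 \ {x ∈ Set.Ioo (0:ℝ) 1 | HasDerivAt (Mfun k a) 0 x})
      = ENNReal.ofReal (dOk a) ∧
    0 < dOk a := by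
  obtain ⟨ha1, hlt⟩ := mul_sq_mul_abs_lt_one ha₀ ha ha' ha''
  have hub := dimH_diff_zero_le ha ha1 hlt ha'' k
  have hlb : ENNReal.ofReal (dOk a) ≤ dimH (nonDiffSet (Mfun k a)) := by
    by_cases h2 : a = 1 / 2
    · subst h2
      exact ofReal_dOk_half_le_dimH_nonDiffSet hk
    · exact ofReal_dOk_le_dimH_nonDiffSet_of_ne_half ha ha1 hlt ha'' h2 k
  have hsub : dimH (nonDiffSet (Mfun k a)) ≤
      dimH (Ioo (0 : ℝ) 1 \ {x ∈ Ioo (0 : ℝ) 1 | HasDerivAt (Mfun k a) 0 x}) :=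
    dimH_mono fun x hx => ⟨hx.1, fun h => hx.2.1 ⟨0, h.2⟩⟩
  have hphi := phiOk_mem ha ha1 hlt ha''
  exact ⟨ae_hasDerivAt_Mfun ha ha1 hlt ha'' k, (hsub.trans hub).antisymm hlb,
    hub.antisymm (hlb.trans hsub), hEnt_pos hphi.1 hphi.2.1⟩
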